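/- Let λ: ℝ → (0,∞) satisfy the admissibility condition. For every integer N ≥ 0 there exist constants C > 0 and M ≥ 0 such that ‖ψ_j Op_ħ(a) ψ_k‖_{L²(dq)→L²(dq)} ≤ C ħ^N ⟨j−k⟩^{−N} |a|_{λ:M,0,0,t} for all t ∈ [0,1], all a ∈ BS^0_0(λ;t), all j, k ∈ ℤ with |j−k| ≥ 2 and all ħ ∈ (0,1]. -/

import Mathlib

open MeasureTheory Real
open scoped BigOperators Classical

noncomputable section

/-- Points of `ℝⁿ`. The coordinate `q 0` plays the role of the radial variable `r`,
the remaining coordinates are the angular variables `θ`. -/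
abbrev Vec (n : ℕ) := Fin n → ℝ

/-- Complex-valued partial derivative in the coordinate direction `i`. -/
def pdC {n : ℕ} (i : Fin n) (f : Vec n → ℂ) : Vec n → ℂ :=
  fun x => fderiv ℝ f x (Pi.single i 1)

/-- Iterated (multiindex) partial derivative `∂^A f`. -/
def mpd {n : ℕ} (A : Fin n → ℕ) (f : Vec n → ℂ) : Vec n → ℂ :=
  (List.finRange n).foldr (fun i g => (pdC i)^[A i] g) f

/-- Real-valued partial derivative in the coordinate direction `i`. -/
def pdR {n : ℕ} (i : Fin n) (f : Vec n → ℝ) : Vec n → ℝ :=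
  fun x => fderiv ℝ f x (Pi.single i 1)

/-- Iterated (multiindex) partial derivative, real valued. -/
def mpdR {n : ℕ} (A : Fin n → ℕ) (f : Vec n → ℝ) : Vec n → ℝ :=
  (List.finRange n).foldr (fun i g => (pdR i)^[A i] g) f

/-- Total length `|A| = α₀ + |α|` of a multiindex. -/
def fullLen {n : ℕ} (A : Fin n → ℕ) : ℕ := ∑ i, A i

/-- Angular length `|α|` of a multiindex `A = (α₀, α)`. -/
def angLen {n : ℕ} [NeZero n] (A : Fin n → ℕ) : ℕ := ∑ i, if i = 0 then 0 else A i

/-- The weighted Japanese bracket `⟨ρ ⊕ μ⁻¹ η⟩ = (1 + ρ² + μ⁻²|η|²)^(1/2)`,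
where `ρ = p 0` and `η` are the remaining coordinates of `p`. -/
def jbr {n : ℕ} [NeZero n] (μ : ℝ) (p : Vec n) : ℝ :=
  Real.sqrt (1 + ∑ i, (if i = 0 then p i else μ⁻¹ * p i) ^ 2)

/-- Derivative `∂_q^A` of a function `a(q, p)` in the first slot. -/
def dqS {n : ℕ} (A : Fin n → ℕ) (a : Vec n → Vec n → ℂ) : Vec n → Vec n → ℂ :=
  fun q p => mpd A (fun x => a x p) q

/-- Derivative `∂_p^B` of a function `a(q, p)` in the second slot. -/
def dpS {n : ℕ} (B : Fin n → ℕ) (a : Vec n → Vec n → ℂ) : Vec n → Vec n → ℂ :=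
  fun q p => mpd B (fun x => a q x) p

/-- Derivative `∂_q^A` of a function `a(q, p, q')` in the first slot. -/
def d1B {n : ℕ} (A : Fin n → ℕ) (a : Vec n → Vec n → Vec n → ℂ) :
    Vec n → Vec n → Vec n → ℂ :=
  fun q p q' => mpd A (fun x => a x p q') q

/-- Derivative `∂_p^B` of a function `a(q, p, q')` in the second slot. -/
def d2B {n : ℕ} (B : Fin n → ℕ) (a : Vec n → Vec n → Vec n → ℂ) :
    Vec n → Vec n → Vec n → ℂ :=
  fun q p q' => mpd B (fun x => a q x q') p

/-- Derivative `∂_{q'}^{A'}` of a function `a(q, p, q')` in the third slot. -/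
def d3B {n : ℕ} (A' : Fin n → ℕ) (a : Vec n → Vec n → Vec n → ℂ) :
    Vec n → Vec n → Vec n → ℂ :=
  fun q p q' => mpd A' (fun x => a q p x) q'

/-- The admissibility condition for the weight `λ : ℝ → (0,∞)`:
`λ` is positive and `C₀⁻¹ ≤ λ(r)/λ(r') ≤ C₀` whenever `|r - r'| ≤ 1`. -/
def Admissible (lam : ℝ → ℝ) : Prop :=
  (∀ r, 0 < lam r) ∧
  ∃ C > 0, ∀ r r' : ℝ, |r - r'| ≤ 1 → C⁻¹ ≤ lam r / lam r' ∧ lam r / lam r' ≤ C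

/-- The symbol class `S^m_σ(λ)`:  `a` is smooth on `ℝ^{2n}` and for all multiindices
`A = (α₀, α)`, `B = (β₀, β)`,
`|(λ(r)⁻¹∂_θ)^α (λ(r)∂_η)^β ∂_r^{α₀} ∂_ρ^{β₀} a(q,p)| ≤ C ⟨ρ ⊕ λ(r)⁻¹η⟩^{m - σ|B|}`.
(The weights `λ(r)^{±1}` commute with the `θ`- and `η`-derivatives, so the weighted
derivative equals `λ(r)^{|β| - |α|}` times the plain mixed partial derivative.) -/
def IsSymbol {n : ℕ} [NeZero n] (lam : ℝ → ℝ) (m σ : ℝ) (a : Vec n → Vec n → ℂ) : Prop :=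
  ContDiff ℝ (⊤ : ℕ∞) (fun x : Vec n × Vec n => a x.1 x.2) ∧
  ∀ A B : Fin n → ℕ, ∃ C > 0, ∀ q p : Vec n,
    lam (q 0) ^ ((angLen B : ℤ) - (angLen A : ℤ)) * ‖dqS A (dpS B a) q p‖
      ≤ C * jbr (lam (q 0)) p ^ (m - σ * (fullLen B : ℝ))

/-- The seminorm `|a|_{λ : M, m, σ}` on the symbol class `S^m_σ(λ)`. -/
def symSeminorm {n : ℕ} [NeZero n] (lam : ℝ → ℝ) (M : ℕ) (m σ : ℝ)
    (a : Vec n → Vec n → ℂ) : ℝ :=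
  ∑ A : Fin n → Fin (M + 1), ∑ B : Fin n → Fin (M + 1),
    if fullLen (fun i => (A i : ℕ)) + fullLen (fun i => (B i : ℕ)) ≤ M then
      ⨆ q : Vec n, ⨆ p : Vec n,
        jbr (lam (q 0)) p ^ (-m + σ * (fullLen (fun i => (B i : ℕ)) : ℝ)) *
          (lam (q 0) ^ ((angLen (fun i => (B i : ℕ)) : ℤ) - (angLen (fun i => (A i : ℕ)) : ℤ)) *
            ‖dqS (fun i => (A i : ℕ)) (dpS (fun i => (B i : ℕ)) a) q p‖)
    else 0

/-- `λ^t_{jk} := λ(tj + (1-t)k)`. -/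
def lamT (lam : ℝ → ℝ) (t : ℝ) (j k : ℤ) : ℝ := lam (t * j + (1 - t) * k)

/-- The bisymbol class `BS^m_σ(λ; t)`. -/
def IsBisymbol {n : ℕ} [NeZero n] (lam : ℝ → ℝ) (m σ t : ℝ)
    (a : Vec n → Vec n → Vec n → ℂ) : Prop :=
  ContDiff ℝ (⊤ : ℕ∞) (fun x : Vec n × Vec n × Vec n => a x.1 x.2.1 x.2.2) ∧
  ∀ A B A' : Fin n → ℕ, ∃ C > 0, ∀ (j k : ℤ) (q p q' : Vec n),
    |q 0 - (j : ℝ)| ≤ 1 → |q' 0 - (k : ℝ)| ≤ 1 →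
    lamT lam t j k ^ ((angLen B : ℤ) - (angLen A : ℤ) - (angLen A' : ℤ)) *
        ‖d1B A (d2B B (d3B A' a)) q p q'‖
      ≤ C * jbr (lamT lam t j k) p ^ (m - σ * (fullLen B : ℝ))

/-- The seminorm `|a|_{λ : M, m, σ, t}` on `BS^m_σ(λ; t)`. -/
def bisymSeminorm {n : ℕ} [NeZero n] (lam : ℝ → ℝ) (M : ℕ) (m σ t : ℝ)
    (a : Vec n → Vec n → Vec n → ℂ) : ℝ :=
  ∑ A : Fin n → Fin (M + 1), ∑ B : Fin n → Fin (M + 1), ∑ A' : Fin n → Fin (M + 1),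
    if fullLen (fun i => (A i : ℕ)) + fullLen (fun i => (B i : ℕ))
        + fullLen (fun i => (A' i : ℕ)) ≤ M then
      ⨆ j : ℤ, ⨆ k : ℤ, ⨆ q : Vec n, ⨆ p : Vec n, ⨆ q' : Vec n,
        if |q 0 - (j : ℝ)| ≤ 1 ∧ |q' 0 - (k : ℝ)| ≤ 1 then
          jbr (lamT lam t j k) p ^ (-m + σ * (fullLen (fun i => (B i : ℕ)) : ℝ)) *
            (lamT lam t j k ^ ((angLen (fun i => (B i : ℕ)) : ℤ)
                - (angLen (fun i => (A i : ℕ)) : ℤ) - (angLen (fun i => (A' i : ℕ)) : ℤ)) *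
              ‖d1B (fun i => (A i : ℕ)) (d2B (fun i => (B i : ℕ))
                  (d3B (fun i => (A' i : ℕ)) a)) q p q'‖)
        else 0
    else 0

/-- The plain bisymbol class `BS^m_σ(1)` (the case `λ ≡ 1`). -/
def IsBisymbolOne {n : ℕ} [NeZero n] (m σ : ℝ) (a : Vec n → Vec n → Vec n → ℂ) : Prop :=
  ContDiff ℝ (⊤ : ℕ∞) (fun x : Vec n × Vec n × Vec n => a x.1 x.2.1 x.2.2) ∧
  ∀ A B A' : Fin n → ℕ, ∃ C > 0, ∀ q p q' : Vec n,
    ‖d1B A (d2B B (d3B A' a)) q p q'‖ ≤ C * jbr 1 p ^ (m - σ * (fullLen B : ℝ))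

/-- The seminorm `|a|_{M, m, σ}` on `BS^m_σ(1)`. -/
def bisymSeminormOne {n : ℕ} [NeZero n] (M : ℕ) (m σ : ℝ)
    (a : Vec n → Vec n → Vec n → ℂ) : ℝ :=
  ∑ A : Fin n → Fin (M + 1), ∑ B : Fin n → Fin (M + 1), ∑ A' : Fin n → Fin (M + 1),
    if fullLen (fun i => (A i : ℕ)) + fullLen (fun i => (B i : ℕ))
        + fullLen (fun i => (A' i : ℕ)) ≤ M then
      ⨆ q : Vec n, ⨆ p : Vec n, ⨆ q' : Vec n,
        jbr 1 p ^ (-m + σ * (fullLen (fun i => (B i : ℕ)) : ℝ)) *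
          ‖d1B (fun i => (A i : ℕ)) (d2B (fun i => (B i : ℕ))
              (d3B (fun i => (A' i : ℕ)) a)) q p q'‖
    else 0

/-- The oscillatory phase `e^{i p · (q - q')}`. -/
def phase {n : ℕ} (p q q' : Vec n) : ℂ :=
  Complex.exp (Complex.I * ((∑ i, p i * (q i - q' i) : ℝ) : ℂ))

/-- The pseudodifferential operator `Op^g(a)` with bisymbol `a`, as an iterated integral:
`Op^g(a)u(q) = (2π)^{-n} g(q)^{-1/4} ∫ dp ∫ dq' a(q,p,q') e^{ip⋅(q-q')} u(q') g(q')^{1/4}`. -/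
def OpG {n : ℕ} (g : Vec n → ℝ) (a : Vec n → Vec n → Vec n → ℂ) (u : Vec n → ℂ) :
    Vec n → ℂ :=
  fun q => (((2 * Real.pi) ^ (-(n : ℤ)) : ℝ) : ℂ) * ((g q ^ (-(1 : ℝ) / 4) : ℝ) : ℂ) *
    ∫ p : Vec n, ∫ q' : Vec n,
      a q p q' * phase p q q' * u q' * ((g q' ^ ((1 : ℝ) / 4) : ℝ) : ℂ)

/-- The pseudodifferential operator `Op(a) = Op^1(a)` with bisymbol `a`. -/
def Op {n : ℕ} (a : Vec n → Vec n → Vec n → ℂ) (u : Vec n → ℂ) : Vec n → ℂ :=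
  fun q => (((2 * Real.pi) ^ (-(n : ℤ)) : ℝ) : ℂ) *
    ∫ p : Vec n, ∫ q' : Vec n, a q p q' * phase p q q' * u q'

/-- The `t`-quantization `Op^{g,t}(a)` of a symbol `a`. -/
def OpSt {n : ℕ} (g : Vec n → ℝ) (t : ℝ) (a : Vec n → Vec n → ℂ) (u : Vec n → ℂ) :
    Vec n → ℂ :=
  OpG g (fun q p q' => a (t • q + (1 - t) • q') p) u

/-- The quantization `Op(b)` of a symbol `b` (the case `t = 1`, `g ≡ 1`). -/
def OpSym {n : ℕ} (b : Vec n → Vec n → ℂ) (u : Vec n → ℂ) : Vec n → ℂ :=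
  Op (fun q p _ => b q p) u

/-- The `L²(g^{1/2}dq)` norm. -/
def L2g {n : ℕ} (g : Vec n → ℝ) (f : Vec n → ℂ) : ℝ :=
  Real.sqrt (∫ q : Vec n, ‖f q‖ ^ 2 * Real.sqrt (g q))

/-- The `L²(dq)` norm. -/
def L2 {n : ℕ} (f : Vec n → ℂ) : ℝ :=
  Real.sqrt (∫ q : Vec n, ‖f q‖ ^ 2)

end

noncomputable section

/-- The semiclassical quantization `Op_ħ(a) := Op(a(q, ħp, q'))`. -/
def Oph {n : ℕ} (h : ℝ) (a : Vec n → Vec n → Vec n → ℂ) (u : Vec n → ℂ) : Vec n → ℂ :=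
  Op (fun q p q' => a q (h • p) q') u

end

section IteratedDerivatives

variable {E F : Type*} [NormedAddCommGroup E] [NormedSpace ℝ E]
  [NormedAddCommGroup F] [NormedSpace ℝ F]

/-- The directional derivative of `f` in the direction `v`. -/
noncomputable def dirD (v : E) (f : E → ℂ) : E → ℂ := fun x => fderiv ℝ f x v

/-- The iterated directional derivative of `f` along a list of directions. -/
noncomputable def iterD (L : List E) (f : E → ℂ) : E → ℂ := L.foldr dirD f

@[simp] lemma iterD_nil (f : E → ℂ) : iterD [] f = f := rfl

@[simp] lemma iterD_cons (v : E) (L : List E) (f : E → ℂ) :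
    iterD (v :: L) f = dirD v (iterD L f) := rfl

lemma iterD_append (L L' : List E) (f : E → ℂ) : iterD (L ++ L') f = iterD L (iterD L' f) := by
  simp [iterD]

lemma contDiff_dirD {f : E → ℂ} (hf : ContDiff ℝ (⊤ : ℕ∞) f) (v : E) :
    ContDiff ℝ (⊤ : ℕ∞) (dirD v f) :=
  (hf.fderiv_right (m := (⊤ : ℕ∞)) (by simp)).clm_apply contDiff_const

lemma contDiff_iterD {f : E → ℂ} (hf : ContDiff ℝ (⊤ : ℕ∞) f) (L : List E) :
    ContDiff ℝ (⊤ : ℕ∞) (iterD L f) := by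
  induction L with
  | nil => exact hf
  | cons v L ih => exact contDiff_dirD ih v

lemma dirD_comm {f : E → ℂ} (hf : ContDiff ℝ (⊤ : ℕ∞) f) (v w : E) :
    dirD v (dirD w f) = dirD w (dirD v f) := by
  have hd : Differentiable ℝ (fderiv ℝ f) :=
    (hf.fderiv_right (m := (⊤ : ℕ∞)) (by simp)).differentiable (by simp)
  have key : ∀ (v w : E) x, dirD v (dirD w f) x = fderiv ℝ (fderiv ℝ f) x v w := by
    intro v w x
    have : HasFDerivAt (fun y => fderiv ℝ f y w)
        ((ContinuousLinearMap.apply ℝ ℂ w).comp (fderiv ℝ (fderiv ℝ f) x)) x :=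
      (ContinuousLinearMap.apply ℝ ℂ w).hasFDerivAt.comp x (hd x).hasFDerivAt
    change fderiv ℝ (fun y => fderiv ℝ f y w) x v = _
    rw [this.fderiv]
    rfl
  ext x
  rw [key, key]
  have h2 : (2 : WithTop ℕ∞) ≤ ((⊤ : ℕ∞) : WithTop ℕ∞) := by
    rw [show (2 : WithTop ℕ∞) = ((2 : ℕ∞) : WithTop ℕ∞) from rfl]
    exact WithTop.coe_le_coe.2 le_top
  exact (hf.contDiffAt.isSymmSndFDerivAt
    (by simpa using h2)).eq v w

lemma iterD_perm {L L' : List E} (h : L.Perm L') {f : E → ℂ} (hf : ContDiff ℝ (⊤ : ℕ∞) f) :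
    iterD L f = iterD L' f := by
  induction h with
  | nil => rfl
  | cons v _ ih => simp [ih]
  | swap v w L => exact dirD_comm (contDiff_iterD hf L) w v
  | trans _ _ h1 h2 => exact h1.trans h2

lemma dirD_smul_dir (c : ℝ) (v : E) (f : E → ℂ) : dirD (c • v) f = c • dirD v f := by
  ext x; simp [dirD]

lemma dirD_smul {f : E → ℂ} (hf : Differentiable ℝ f) (c : ℂ) (v : E) :
    dirD v (c • f) = c • dirD v f := by
  ext x
  simp only [dirD, Pi.smul_apply]
  rw [fderiv_const_smul (hf x)]
  rfl

lemma dirD_add {f g : E → ℂ} (hf : Differentiable ℝ f) (hg : Differentiable ℝ g) (v : E) :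
    dirD v (f + g) = dirD v f + dirD v g := by
  ext x
  simp only [dirD, Pi.add_apply]
  rw [fderiv_add (hf x) (hg x)]
  rfl

lemma dirD_mul {f g : E → ℂ} (hf : Differentiable ℝ f) (hg : Differentiable ℝ g) (v : E) :
    dirD v (f * g) = dirD v f * g + f * dirD v g := by
  ext x
  simp only [dirD, Pi.add_apply, Pi.mul_apply]
  rw [fderiv_mul (hf x) (hg x)]
  simp
  ring

lemma iterD_add {f g : E → ℂ} (hf : ContDiff ℝ (⊤ : ℕ∞) f) (hg : ContDiff ℝ (⊤ : ℕ∞) g)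
    (L : List E) : iterD L (f + g) = iterD L f + iterD L g := by
  induction L with
  | nil => rfl
  | cons v L ih =>
    rw [iterD_cons, ih, dirD_add ((contDiff_iterD hf L).differentiable (by simp))
      ((contDiff_iterD hg L).differentiable (by simp))]
    rfl

lemma iterD_smul {f : E → ℂ} (hf : ContDiff ℝ (⊤ : ℕ∞) f) (c : ℂ) (L : List E) :
    iterD L (c • f) = c • iterD L f := by
  induction L with
  | nil => rfl
  | cons v L ih =>
    rw [iterD_cons, ih, dirD_smul ((contDiff_iterD hf L).differentiable (by simp))]
    rfl

lemma dirD_comp_affine {f : F → ℂ} (hf : Differentiable ℝ f) (c : F) (T : E →L[ℝ] F) (v : E) :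
    dirD v (fun y => f (c + T y)) = fun y => dirD (T v) f (c + T y) := by
  ext y
  have h : HasFDerivAt (fun y => f (c + T y)) ((fderiv ℝ f (c + T y)).comp T) y :=
    (hf _).hasFDerivAt.comp y (T.hasFDerivAt.const_add c)
  simp only [dirD]
  rw [h.fderiv]
  rfl

lemma iterD_comp_affine {f : F → ℂ} (hf : ContDiff ℝ (⊤ : ℕ∞) f) (c : F) (T : E →L[ℝ] F)
    (L : List E) :
    iterD L (fun y => f (c + T y)) = fun y => iterD (L.map T) f (c + T y) := by
  induction L with
  | nil => rfl
  | cons v L ih =>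
    rw [iterD_cons, ih, dirD_comp_affine ((contDiff_iterD hf _).differentiable (by simp))]
    rfl

lemma tsupport_iterD_subset (f : E → ℂ) (L : List E) : tsupport (iterD L f) ⊆ tsupport f := by
  induction L with
  | nil => exact subset_rfl
  | cons v L ih =>
    refine (closure_minimal ?_ (isClosed_tsupport _)).trans ih
    intro x hx
    refine support_fderiv_subset ℝ (f := iterD L f) ?_
    intro h0
    apply hx
    simp [dirD, h0]

lemma iterD_real_line (f : ℝ → ℂ) (hf : ContDiff ℝ (⊤ : ℕ∞) f) (L : List ℝ) :
    iterD L f = ((L.prod : ℝ) : ℂ) • iteratedDeriv L.length f := by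
  induction L with
  | nil => ext; simp
  | cons v L ih =>
    have hd : Differentiable ℝ (iteratedDeriv L.length f) :=
      hf.differentiable_iteratedDeriv _ (by exact_mod_cast WithTop.coe_lt_top _)
    rw [iterD_cons, ih, dirD_smul hd]
    ext x
    simp only [dirD, Pi.smul_apply, List.length_cons, iteratedDeriv_succ, List.prod_cons,
      smul_eq_mul, Complex.ofReal_mul]
    rw [← fderiv_apply_one_eq_deriv]
    have : (fderiv ℝ (iteratedDeriv L.length f) x) v
        = (v : ℂ) * (fderiv ℝ (iteratedDeriv L.length f) x) 1 := by
      conv_lhs => rw [← mul_one v, ← smul_eq_mul, map_smul]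
      simp
    rw [this]; ring

/-- All iterated derivatives of `f` at `z` of order at most `m` along directions in `S` are
bounded by `C`. -/
def DBound (S : Set E) (m : ℕ) (C : ℝ) (f : E → ℂ) (z : E) : Prop :=
  ∀ L : List E, (∀ v ∈ L, v ∈ S) → L.length ≤ m → ‖iterD L f z‖ ≤ C

lemma DBound.nonneg {S : Set E} {m : ℕ} {C : ℝ} {f : E → ℂ} {z : E} (h : DBound S m C f z) :
    0 ≤ C := (norm_nonneg _).trans (h [] (by simp) (by simp))

lemma DBound.norm_le {S : Set E} {m : ℕ} {C : ℝ} {f : E → ℂ} {z : E} (h : DBound S m C f z) :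
    ‖f z‖ ≤ C := h [] (by simp) (by simp)

lemma DBound.mono {S : Set E} {m m' : ℕ} {C C' : ℝ} {f : E → ℂ} {z : E} (h : DBound S m C f z)
    (hm : m' ≤ m) (hC : C ≤ C') : DBound S m' C' f z :=
  fun L hL hl => (h L hL (hl.trans hm)).trans hC

lemma DBound.dirD {S : Set E} {m : ℕ} {C : ℝ} {f : E → ℂ} {z v : E}
    (h : DBound S (m + 1) C f z) (hv : v ∈ S) : DBound S m C (dirD v f) z := by
  intro L hL hl
  have := h (L ++ [v]) (by simpa [or_imp, forall_and] using ⟨hL, hv⟩) (by simpa using hl)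
  rwa [iterD_append] at this

lemma DBound.add {S : Set E} {m : ℕ} {C C' : ℝ} {f g : E → ℂ} {z : E}
    (h : DBound S m C f z) (h' : DBound S m C' g z)
    (hf : ContDiff ℝ (⊤ : ℕ∞) f) (hg : ContDiff ℝ (⊤ : ℕ∞) g) :
    DBound S m (C + C') (f + g) z := by
  intro L hL hl
  rw [iterD_add hf hg]
  exact (norm_add_le _ _).trans (add_le_add (h L hL hl) (h' L hL hl))

lemma DBound.smul {S : Set E} {m : ℕ} {C : ℝ} {f : E → ℂ} {z : E}
    (h : DBound S m C f z) (hf : ContDiff ℝ (⊤ : ℕ∞) f) (c : ℂ) :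
    DBound S m (‖c‖ * C) (c • f) z := by
  intro L hL hl
  rw [iterD_smul hf, Pi.smul_apply, norm_smul]
  exact mul_le_mul_of_nonneg_left (h L hL hl) (norm_nonneg _)

lemma DBound.mul {S : Set E} {m : ℕ} : ∀ {C C' : ℝ} {f g : E → ℂ} {z : E},
    DBound S m C f z → DBound S m C' g z →
    ContDiff ℝ (⊤ : ℕ∞) f → ContDiff ℝ (⊤ : ℕ∞) g →
    DBound S m (2 ^ m * (C * C')) (f * g) z := by
  induction m with
  | zero =>
    intro C C' f g z h h' hf hg L hL hl
    obtain rfl : L = [] := List.length_eq_zero_iff.1 (by lia)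
    simpa using mul_le_mul h.norm_le h'.norm_le (norm_nonneg _) h.nonneg
  | succ m ih =>
    intro C C' f g z h h' hf hg L hL hl
    have hCC : 0 ≤ C * C' := mul_nonneg h.nonneg h'.nonneg
    rcases L.eq_nil_or_concat' with rfl | ⟨L, v, rfl⟩
    · have : ‖f z * g z‖ ≤ C * C' := by
        rw [norm_mul]; exact mul_le_mul h.norm_le h'.norm_le (norm_nonneg _) h.nonneg
      refine this.trans (le_mul_of_one_le_left hCC (one_le_pow₀ (by norm_num)))
    · have hv : v ∈ S := hL v (by simp)
      rw [iterD_append]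
      simp only [iterD_cons, iterD_nil]
      rw [dirD_mul (hf.differentiable (by simp)) (hg.differentiable (by simp))]
      have h1 := ih (h.dirD hv) (h'.mono (Nat.le_succ m) le_rfl) (contDiff_dirD hf v) hg
      have h2 := ih (h.mono (Nat.le_succ m) le_rfl) (h'.dirD hv) hf (contDiff_dirD hg v)
      have h3 := (h1.add h2 ((contDiff_dirD hf v).mul hg) (hf.mul (contDiff_dirD hg v))) L
        (fun w hw => hL w (by simp [hw])) (by simpa using hl)
      refine h3.trans (le_of_eq ?_)
      ring

lemma DBound.comp_affine {S : Set E} {S' : Set F} {m : ℕ} {C : ℝ} {f : F → ℂ} {z : E}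
    (c : F) (T : E →L[ℝ] F) (hT : ∀ v ∈ S, T v ∈ S') (h : DBound S' m C f (c + T z))
    (hf : ContDiff ℝ (⊤ : ℕ∞) f) : DBound S m C (fun y => f (c + T y)) z := by
  intro L hL hl
  rw [iterD_comp_affine hf]
  refine h _ ?_ (by simpa using hl)
  intro w hw
  obtain ⟨v, hv, rfl⟩ := List.mem_map.1 hw
  exact hT v (hL v hv)

lemma dBound_zero_of_notMem_tsupport {f : E → ℂ} {z : E} (hz : z ∉ tsupport f) (S : Set E)
    (m : ℕ) : DBound S m 0 f z := by
  intro L _ _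
  rw [image_eq_zero_of_notMem_tsupport (fun h => hz (tsupport_iterD_subset f L h))]
  simp

/-- Smooth functions with compact support on the line have bounded derivatives. -/
lemma exists_dBound_of_hasCompactSupport {f : ℝ → ℂ} (hf : ContDiff ℝ (⊤ : ℕ∞) f)
    (hc : HasCompactSupport f) (m : ℕ) :
    ∃ C, 0 ≤ C ∧ ∀ z, DBound (Metric.closedBall 0 1) m C f z := by
  have h1 : ∀ l : ℕ, ∃ C, 0 ≤ C ∧ ∀ z, ‖iteratedDeriv l f z‖ ≤ C := by
    intro l
    have e : iteratedDeriv l f = iterD (List.replicate l (1 : ℝ)) f := by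
      rw [iterD_real_line f hf]; simp
    have hcont : Continuous (iteratedDeriv l f) := by
      rw [e]; exact (contDiff_iterD hf _).continuous
    have hcs : HasCompactSupport (iteratedDeriv l f) := by
      rw [e]; exact hc.of_isClosed_subset (isClosed_tsupport _) (tsupport_iterD_subset f _)
    obtain ⟨C, hC⟩ := hcs.exists_bound_of_continuous hcont
    exact ⟨C, (norm_nonneg _).trans (hC 0), hC⟩
  choose C hC0 hC using h1
  refine ⟨∑ l ∈ Finset.range (m + 1), C l, Finset.sum_nonneg fun l _ => hC0 l, ?_⟩
  intro z L hL hl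
  rw [iterD_real_line f hf, Pi.smul_apply, norm_smul, Complex.norm_real]
  have hp : ‖L.prod‖ ≤ 1 := by
    clear hl
    induction L with
    | nil => simp
    | cons v L ih =>
      rw [List.prod_cons, norm_mul]
      have h2 : ‖v‖ ≤ 1 := by simpa using hL v (by simp)
      exact mul_le_one₀ h2 (norm_nonneg _) (ih fun w hw => hL w (by simp [hw]))
  calc ‖L.prod‖ * ‖iteratedDeriv L.length f z‖ ≤ 1 * C L.length :=
        mul_le_mul hp (hC _ _) (norm_nonneg _) zero_le_one
    _ = C L.length := one_mul _
    _ ≤ _ := Finset.single_le_sum (f := C) (fun l _ => hC0 l) (Finset.mem_range.2 (by lia))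

/-- The reciprocal `(θ + i T z)⁻¹` of an affine function. -/
noncomputable def recip (θ : ℝ) (T : E →L[ℝ] ℝ) : E → ℂ :=
  fun z => ((θ : ℂ) + Complex.I * (T z : ℂ))⁻¹

lemma recip_denom_ne_zero {θ : ℝ} (hθ : 0 < θ) (s : ℝ) : (θ : ℂ) + Complex.I * (s : ℂ) ≠ 0 := by
  intro h
  have := congrArg Complex.re h
  simp at this
  exact hθ.ne' this

lemma contDiff_recip {θ : ℝ} (hθ : 0 < θ) (T : E →L[ℝ] ℝ) :
    ContDiff ℝ (⊤ : ℕ∞) (recip θ T) := by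
  have h1 : ContDiff ℝ (⊤ : ℕ∞) (fun z => ((θ : ℂ) + Complex.I * (T z : ℂ))) :=
    contDiff_const.add (contDiff_const.mul (Complex.ofRealCLM.contDiff.comp T.contDiff))
  exact h1.inv fun z => recip_denom_ne_zero hθ _

lemma dirD_recip {θ : ℝ} (hθ : 0 < θ) (T : E →L[ℝ] ℝ) (v : E) :
    dirD v (recip θ T) = (-(Complex.I * (T v : ℂ))) • (recip θ T * recip θ T) := by
  ext z
  have h1 : HasFDerivAt (fun z => ((θ : ℂ) + Complex.I * (T z : ℂ)))
      (Complex.I • (Complex.ofRealCLM.comp T)) z :=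
    ((Complex.ofRealCLM.hasFDerivAt.comp z T.hasFDerivAt).const_mul Complex.I).const_add _
  have h2 := (hasDerivAt_inv (recip_denom_ne_zero hθ (T z))).comp_hasFDerivAt z
    (h1)
  have h3 : HasFDerivAt (recip θ T) _ z := h2
  simp only [dirD]
  rw [h3.fderiv]
  simp [recip]
  field_simp

lemma dBound_recip {θ : ℝ} (hθ : 0 < θ) (T : E →L[ℝ] ℝ) {S : Set E} (hT : ∀ v ∈ S, |T v| ≤ 1)
    {K : ℝ} {z : E} (hz : ‖recip θ T z‖ ≤ K) (m : ℕ) :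
    DBound S m (m.factorial * (1 + K) ^ m * ‖recip θ T z‖) (recip θ T) z := by
  have hK : 0 ≤ K := (norm_nonneg _).trans hz
  have key : ∀ L : List E, (∀ v ∈ L, v ∈ S) → ∃ c : ℂ, ‖c‖ ≤ L.length.factorial ∧
      iterD L (recip θ T) = c • (recip θ T) ^ (L.length + 1) := by
    intro L
    induction L with
    | nil => exact fun _ => ⟨1, by simp, by simp⟩
    | cons v L ih =>
      intro hL
      obtain ⟨c, hc, e⟩ := ih fun w hw => hL w (by simp [hw])
      refine ⟨c * ((L.length + 1 : ℕ) * (-(Complex.I * (T v : ℂ)))), ?_, ?_⟩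
      · have hv := hT v (hL v (by simp))
        have e3 : ‖((L.length + 1 : ℕ) : ℂ)‖ = ((L.length + 1 : ℕ) : ℝ) :=
          Complex.norm_natCast _
        rw [norm_mul, norm_mul, e3, norm_neg, norm_mul, Complex.norm_I, Complex.norm_real,
          one_mul, List.length_cons, Nat.factorial_succ, Nat.cast_mul, Real.norm_eq_abs]
        calc ‖c‖ * (((L.length + 1 : ℕ) : ℝ) * |T v|)
            ≤ (L.length.factorial : ℝ) * (((L.length + 1 : ℕ) : ℝ) * 1) := by gcongr
          _ = _ := by ring
      · have hs := contDiff_recip hθ T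
        have hd : Differentiable ℝ (recip θ T ^ (L.length + 1)) :=
          (hs.pow (L.length + 1)).differentiable (by simp)
        rw [iterD_cons, e, dirD_smul hd]
        ext x
        have h1 := dirD_recip hθ T v
        have h2 : dirD v (recip θ T ^ (L.length + 1)) x
            = ((L.length + 1 : ℕ) : ℂ) * recip θ T x ^ L.length * dirD v (recip θ T) x := by
          simp only [dirD]
          have h3 := ((hs.differentiable (by simp) x).hasFDerivAt).pow (L.length + 1)
          have h4 : HasFDerivAt (recip θ T ^ (L.length + 1)) _ x := h3
          rw [h4.fderiv]
          simp
        simp only [Pi.smul_apply, smul_eq_mul, Pi.pow_apply, h2, h1, Pi.mul_apply,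
          List.length_cons]
        ring
  intro L hL hl
  obtain ⟨c, hc, e⟩ := key L hL
  rw [e, Pi.smul_apply, norm_smul, Pi.pow_apply, norm_pow, pow_succ]
  have h1 : (L.length.factorial : ℝ) ≤ m.factorial := by
    exact_mod_cast Nat.factorial_le hl
  have h2 : ‖recip θ T z‖ ^ L.length ≤ (1 + K) ^ m :=
    (pow_le_pow_left₀ (norm_nonneg _) (hz.trans (by linarith)) _).trans
      (pow_le_pow_right₀ (by linarith) hl)
  rw [← mul_assoc]
  gcongr
  exact hc.trans h1

end IteratedDerivatives

section FourierL2

open scoped FourierTransform ENNReal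

lemma lintegral_enorm_fourier_sq {V : Type*} [NormedAddCommGroup V] [InnerProductSpace ℝ V]
    [FiniteDimensional ℝ V] [MeasurableSpace V] [BorelSpace V] {w : V → ℂ}
    (h1 : Integrable w) (h2 : MemLp w 2) :
    ∫⁻ ξ, ‖𝓕 w ξ‖ₑ ^ 2 = ∫⁻ x, ‖w x‖ₑ ^ 2 := by
  set f : Lp ℂ 2 (volume : Measure V) := h2.toLp w with hf
  set g : Lp ℂ 2 (volume : Measure V) := 𝓕 f with hg
  have hcont : Continuous (𝓕 w) :=
    VectorFourier.fourierIntegral_continuous Real.continuous_fourierChar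
      (by exact continuous_inner) h1
  have hae : ∀ᵐ ξ, 𝓕 w ξ = g ξ := by
    refine ae_eq_of_integral_contDiff_smul_eq hcont.locallyIntegrable
      ((Lp.memLp g).locallyIntegrable (by norm_num)) ?_
    intro φ hφ hφc
    have hc1 : HasCompactSupport (fun x => (φ x : ℂ)) := hφc.comp_left (g := fun r : ℝ => (r : ℂ)) (by simp)
    have hc2 : ContDiff ℝ (⊤ : ℕ∞) (fun x => (φ x : ℂ)) := Complex.ofRealCLM.contDiff.comp hφ
    set Φ : SchwartzMap V ℂ := hc1.toSchwartzMap hc2 with hΦ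
    have e1 : ∀ x, Φ x = (φ x : ℂ) := fun x => rfl
    have e2 : Lp.toTemperedDistribution g Φ = Lp.toTemperedDistribution f (𝓕 Φ) := by
      rw [hg, ← Lp.fourier_toTemperedDistribution_eq, TemperedDistribution.fourier_apply]
    rw [Lp.toTemperedDistribution_apply, Lp.toTemperedDistribution_apply] at e2
    have e3 : ∫ x, (𝓕 Φ) x • f x = ∫ x, (𝓕 Φ) x • w x := by
      apply integral_congr_ae
      filter_upwards [h2.coeFn_toLp] with x hx
      rw [hx]
    have e4 : ∫ x, (𝓕 Φ) x • w x = ∫ x, Φ x • 𝓕 w x := by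
      have := VectorFourier.integral_fourierIntegral_smul_eq_flip (L := innerₗ V)
        (μ := volume) (ν := volume) (f := Φ) (g := w) Real.continuous_fourierChar
        (by exact continuous_inner) Φ.integrable h1
      rw [flip_innerₗ] at this
      exact this
    calc ∫ x, φ x • 𝓕 w x = ∫ x, Φ x • 𝓕 w x := by simp [e1]
      _ = ∫ x, Φ x • g x := by rw [e2, e3, e4]
      _ = ∫ x, φ x • g x := by simp [e1]
  have hn : ‖g‖ = ‖f‖ := Lp.norm_fourier_eq f
  have hen : eLpNorm g 2 volume = eLpNorm w 2 volume := by
    have : ‖g‖ₑ = ‖f‖ₑ := by simp [enorm_eq_nnnorm, ← NNReal.coe_inj, hn]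
    rw [Lp.enorm_def, Lp.enorm_def] at this
    rw [this]
    exact eLpNorm_congr_ae h2.coeFn_toLp
  have hsq : ∀ F : V → ℂ, ∫⁻ x, ‖F x‖ₑ ^ 2 = eLpNorm F 2 volume ^ (2 : ℝ) := by
    intro F
    rw [eLpNorm_eq_lintegral_rpow_enorm_toReal (by norm_num) (by norm_num)]
    rw [← ENNReal.rpow_mul]
    simp
  rw [hsq w, ← hen, ← hsq]
  apply lintegral_congr_ae
  filter_upwards [hae] with x hx
  rw [hx]

/-- Coordinatewise multiplication on `ι → ℝ` as a measurable equivalence scaling volume. -/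
lemma map_mul_volume_pi {ι : Type*} [Fintype ι] {s : ι → ℝ} (hs : ∀ i, s i ≠ 0) :
    ENNReal.ofReal |∏ i, s i| • Measure.map (fun y : ι → ℝ => fun i => s i * y i) volume
      = (volume : Measure (ι → ℝ)) := by
  have h := Real.smul_map_diagonal_volume_pi (D := s)
    (by rw [Matrix.det_diagonal]; exact Finset.prod_ne_zero_iff.2 fun i _ => hs i)
  rw [Matrix.det_diagonal] at h
  convert h using 3
  ext y i
  simp [Matrix.mulVec_diagonal]

lemma measurableEmbedding_mul_pi {ι : Type*} [Fintype ι] {s : ι → ℝ} (hs : ∀ i, s i ≠ 0) :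
    MeasurableEmbedding (fun y : ι → ℝ => fun i => s i * y i) := by
  let e : (ι → ℝ) ≃ₜ (ι → ℝ) :=
    { toFun := fun y i => s i * y i
      invFun := fun y i => (s i)⁻¹ * y i
      left_inv := fun y => by ext i; simp [hs i]
      right_inv := fun y => by ext i; simp [hs i]
      continuous_toFun := by fun_prop
      continuous_invFun := by fun_prop }
  exact e.measurableEmbedding

lemma integral_comp_mul_pi {ι : Type*} [Fintype ι] {s : ι → ℝ} (hs : ∀ i, s i ≠ 0)
    {F : Type*} [NormedAddCommGroup F] [NormedSpace ℝ F] (f : (ι → ℝ) → F) :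
    ∫ y, f y = |∏ i, s i| • ∫ y : ι → ℝ, f (fun i => s i * y i) := by
  conv_lhs => rw [← map_mul_volume_pi hs]
  rw [integral_smul_measure, (measurableEmbedding_mul_pi hs).integral_map,
    ENNReal.toReal_ofReal (abs_nonneg _)]

lemma lintegral_comp_mul_pi {ι : Type*} [Fintype ι] {s : ι → ℝ} (hs : ∀ i, s i ≠ 0)
    (f : (ι → ℝ) → ℝ≥0∞) :
    ∫⁻ y, f y = ENNReal.ofReal |∏ i, s i| * ∫⁻ y : ι → ℝ, f (fun i => s i * y i) := by
  conv_lhs => rw [← map_mul_volume_pi hs]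
  rw [lintegral_smul_measure, (measurableEmbedding_mul_pi hs).lintegral_map]
  rfl

/-- Plancherel's inequality on `ℝⁿ` with the phase `e^{-ip⋅y}`. -/
lemma lintegral_enorm_fourier_le {n : ℕ} {w : (Fin n → ℝ) → ℂ} (h1 : Integrable w) :
    ∫⁻ p : Fin n → ℝ, ‖∫ y, Complex.exp (-(Complex.I * ((∑ i, p i * y i : ℝ) : ℂ))) * w y‖ₑ ^ 2
      ≤ ENNReal.ofReal ((2 * π) ^ n) * ∫⁻ y, ‖w y‖ₑ ^ 2 := by
  by_cases htop : ∫⁻ y, ‖w y‖ₑ ^ 2 = ⊤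
  · rw [htop, ENNReal.mul_top]
    · exact le_top
    · simp; positivity
  set W : EuclideanSpace ℝ (Fin n) → ℂ := fun v => w v.ofLp with hW
  have hmp := PiLp.volume_preserving_ofLp (Fin n)
  have hemb : MeasurableEmbedding (@WithLp.ofLp 2 (Fin n → ℝ)) :=
    (MeasurableEquiv.toLp 2 (Fin n → ℝ)).symm.measurableEmbedding
  have hW1 : Integrable W := (hmp.integrable_comp_emb hemb).2 h1
  have hW2 : ∫⁻ v, ‖W v‖ₑ ^ 2 = ∫⁻ y, ‖w y‖ₑ ^ 2 :=
    hmp.lintegral_comp_emb hemb (fun y => ‖w y‖ₑ ^ 2)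
  have hm : MemLp W 2 := by
    refine ⟨hW1.1, ?_⟩
    rw [eLpNorm_lt_top_iff_lintegral_rpow_enorm_lt_top (by norm_num) (by norm_num)]
    simp only [ENNReal.toReal_ofNat, ENNReal.rpow_ofNat]
    rw [hW2]; exact lt_top_iff_ne_top.2 htop
  have key := lintegral_enorm_fourier_sq hW1 hm
  rw [hW2] at key
  rw [lintegral_comp_mul_pi (s := fun _ : Fin n => 2 * π) (fun _ => by positivity), ← key,
    ← hmp.symm (MeasurableEquiv.toLp 2 (Fin n → ℝ)).symm |>.lintegral_comp_emb
      (MeasurableEquiv.toLp 2 (Fin n → ℝ)).measurableEmbedding]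
  have e : |∏ _i : Fin n, (2 * π)| = (2 * π) ^ n := by
    rw [Finset.prod_const, Finset.card_univ, Fintype.card_fin, abs_of_pos (by positivity)]
  rw [e]
  apply le_of_eq
  congr 1
  apply lintegral_congr
  intro ξ
  congr 2
  rw [Real.fourier_eq', ← hmp.integral_comp hemb]
  apply integral_congr_ae
  refine Filter.Eventually.of_forall fun v => ?_
  simp only [hW, smul_eq_mul]
  congr 2
  simp [PiLp.inner_apply, Finset.mul_sum]
  rw [Finset.sum_mul]
  exact Finset.sum_congr rfl fun i _ => by ring

end FourierL2

section FirstOrderOperators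

variable {E : Type*} [NormedAddCommGroup E] [NormedSpace ℝ E]
  {F : Type*} [NormedAddCommGroup F] [NormedSpace ℝ F]

/-- The differential operator `∏_{v ∈ L} (1 + ∂_v)`. -/
noncomputable def opP (L : List E) (f : E → ℂ) : E → ℂ := L.foldr (fun v g => g + dirD v g) f

@[simp] lemma opP_nil (f : E → ℂ) : opP [] f = f := rfl

@[simp] lemma opP_cons (v : E) (L : List E) (f : E → ℂ) :
    opP (v :: L) f = opP L f + dirD v (opP L f) := rfl

lemma opP_append (L L' : List E) (f : E → ℂ) : opP (L ++ L') f = opP L (opP L' f) := by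
  simp [opP]

lemma contDiff_opP {f : E → ℂ} (hf : ContDiff ℝ (⊤ : ℕ∞) f) (L : List E) :
    ContDiff ℝ (⊤ : ℕ∞) (opP L f) := by
  induction L with
  | nil => exact hf
  | cons v L ih => exact ih.add (contDiff_dirD ih v)

lemma DBound.opP {S : Set E} {C : ℝ} {f : E → ℂ} {z : E} {L : List E} :
    ∀ {m : ℕ}, DBound S (m + L.length) C f z → ContDiff ℝ (⊤ : ℕ∞) f → (∀ v ∈ L, v ∈ S) →
      DBound S m (2 ^ L.length * C) (opP L f) z := by
  induction L with
  | nil => intro m h hf hL; simpa using h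
  | cons v L ih =>
    intro m h hf hL
    have h1 := ih (m := m + 1) (h.mono (by simp; omega) le_rfl) hf fun w hw => hL w (by simp [hw])
    have h2 := (h1.mono (Nat.le_succ m) le_rfl).add (h1.dirD (hL v (by simp)))
      (contDiff_opP hf L) (contDiff_dirD (contDiff_opP hf L) v)
    refine h2.mono le_rfl (le_of_eq ?_)
    rw [List.length_cons]; ring

lemma opP_comp_affine {f : F → ℂ} (hf : ContDiff ℝ (⊤ : ℕ∞) f) (c : F) (T : E →L[ℝ] F)
    (L : List E) :
    opP L (fun y => f (c + T y)) = fun y => opP (L.map T) f (c + T y) := by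
  induction L with
  | nil => rfl
  | cons v L ih =>
    rw [opP_cons, ih, dirD_comp_affine ((contDiff_opP hf _).differentiable (by simp))]
    rfl

lemma tsupport_opP_subset (f : E → ℂ) (L : List E) : tsupport (opP L f) ⊆ tsupport f := by
  induction L with
  | nil => exact subset_rfl
  | cons v L ih =>
    refine (tsupport_add _ _).trans (Set.union_subset ih ?_)
    exact (tsupport_iterD_subset (opP L f) [v]).trans ih

end FirstOrderOperators

section ExponentialKernel

open Filter Topology

/-- The one-sided exponential kernel `e^{-s} 1_{s > 0}`. -/
noncomputable def expKer (s : ℝ) : ℝ := if 0 < s then Real.exp (-s) else 0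

lemma expKer_nonneg (s : ℝ) : 0 ≤ expKer s := by unfold expKer; split_ifs <;> positivity

lemma expKer_le_one (s : ℝ) : expKer s ≤ 1 := by
  unfold expKer; split_ifs with h
  · simp [h.le]
  · exact zero_le_one

lemma measurable_expKer : Measurable expKer :=
  Measurable.ite measurableSet_Ioi (by fun_prop) measurable_const

lemma expKer_eq_indicator : expKer = (Set.Ioi 0).indicator (fun s => Real.exp (-s)) := by
  ext s; simp [expKer, Set.indicator]

lemma integrable_expKer : Integrable expKer := by
  rw [expKer_eq_indicator, integrable_indicator_iff measurableSet_Ioi]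
  exact integrableOn_exp_neg_Ioi 0

lemma integral_expKer : ∫ s, expKer s = 1 := by
  rw [expKer_eq_indicator, integral_indicator measurableSet_Ioi]
  exact integral_exp_neg_Ioi_zero

lemma integral_expKer_sub_mul {φ φ' : ℝ → ℂ} (hφ : ∀ z, HasDerivAt φ (φ' z) z) {C : ℝ}
    (hc : Continuous φ') (h0 : ∀ z, ‖φ z‖ ≤ C) (h1 : ∀ z, ‖φ' z‖ ≤ C) (y : ℝ) :
    ∫ z, (expKer (y - z) : ℂ) * (φ z + φ' z) = φ y := by
  have hcφ : Continuous φ := continuous_iff_continuousAt.2 fun z => (hφ z).continuousAt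
  have e : (fun z => (expKer (y - z) : ℂ) * (φ z + φ' z)) =
      (Set.Iio y).indicator (fun z => (Real.exp (z - y) : ℂ) * (φ z + φ' z)) := by
    ext z
    simp only [expKer, Set.indicator, Set.mem_Iio, sub_pos, neg_sub]
    split_ifs <;> simp
  rw [e, integral_indicator measurableSet_Iio, ← integral_Iic_eq_integral_Iio]
  have hd : ∀ z, HasDerivAt (fun z => (Real.exp (z - y) : ℂ) * φ z)
      ((Real.exp (z - y) : ℂ) * (φ z + φ' z)) z := by
    intro z
    have hE : HasDerivAt (fun z => (Real.exp (z - y) : ℂ)) (Real.exp (z - y) : ℂ) z := by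
      have : HasDerivAt (fun z => Real.exp (z - y)) (Real.exp (z - y)) z := by
        simpa using ((hasDerivAt_id z).sub_const y).exp
      exact this.ofReal_comp
    rw [mul_add]
    exact hE.mul (hφ z)
  have hexp : IntegrableOn (fun z => Real.exp (z - y)) (Set.Iic y) := by
    have := (integrableOn_exp_Iic y).mul_const (Real.exp (-y))
    simp only [← Real.exp_add, ← sub_eq_add_neg] at this
    exact this
  have h_integrable : IntegrableOn (fun z => (Real.exp (z - y) : ℂ) * (φ z + φ' z)) (Set.Iic y) := by
    refine Integrable.mono' (hexp.const_mul (C + C)) ?_ ?_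
    · exact (by fun_prop : Continuous fun z => (Real.exp (z - y) : ℂ) * (φ z + φ' z)).aestronglyMeasurable
    · refine Eventually.of_forall fun z => ?_
      rw [norm_mul, Complex.norm_real, Real.norm_of_nonneg (Real.exp_pos _).le, mul_comm]
      exact mul_le_mul_of_nonneg_right ((norm_add_le _ _).trans (add_le_add (h0 z) (h1 z)))
        (Real.exp_pos _).le
  have ht : Tendsto (fun z => (Real.exp (z - y) : ℂ) * φ z) atBot (𝓝 0) := by
    have h2 : Tendsto (fun z => Real.exp (z - y) * C) atBot (𝓝 0) := by
      have := (tendsto_exp_atBot.comp (tendsto_atBot_add_const_right atBot (-y) tendsto_id)).mul_const C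
      simpa [Function.comp_def, sub_eq_add_neg] using this
    refine squeeze_zero_norm (fun z => ?_) h2
    rw [norm_mul, Complex.norm_real, Real.norm_of_nonneg (Real.exp_pos _).le]
    exact mul_le_mul_of_nonneg_left (h0 z) (Real.exp_pos _).le
  rw [integral_Iic_of_hasDerivAt_of_tendsto' (fun z _ => hd z) h_integrable ht]
  simp

/-- The product kernel `∏ e^{-s_i} 1_{s_i > 0}`. -/
noncomputable def prodKer {n : ℕ} (s : Fin n → ℝ) : ℝ := ∏ i, expKer (s i)

lemma prodKer_nonneg {n : ℕ} (s : Fin n → ℝ) : 0 ≤ prodKer s :=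
  Finset.prod_nonneg fun _ _ => expKer_nonneg _

lemma prodKer_le_one {n : ℕ} (s : Fin n → ℝ) : prodKer s ≤ 1 :=
  Finset.prod_le_one (fun _ _ => expKer_nonneg _) fun _ _ => expKer_le_one _

lemma measurable_prodKer {n : ℕ} : Measurable (prodKer (n := n)) :=
  Finset.measurable_prod _ fun i _ => measurable_expKer.comp (measurable_pi_apply i)

lemma integrable_prodKer {n : ℕ} : Integrable (prodKer (n := n)) :=
  Integrable.fintype_prod fun _ => integrable_expKer

lemma integral_prodKer {n : ℕ} : ∫ s : Fin n → ℝ, prodKer s = 1 := by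
  simp only [prodKer]
  rw [integral_fintype_prod_volume_eq_prod (fun (_ : Fin n) => expKer)]
  simp [integral_expKer]

/-- The list of coordinate directions. -/
noncomputable def coordList (n : ℕ) : List (Fin n → ℝ) :=
  (List.finRange n).map fun i => Pi.single i 1

lemma length_coordList (n : ℕ) : (coordList n).length = n := by simp [coordList]

lemma coordList_succ (n : ℕ) : coordList (n + 1) =
    Pi.single 0 1 :: (coordList n).map (fun v => (Fin.cons 0 v : Fin (n + 1) → ℝ)) := by
  simp only [coordList, List.finRange_succ, List.map_cons, List.map_map]
  congr 1
  apply List.map_congr_left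
  intro i _
  ext j
  refine Fin.cases ?_ (fun j => ?_) j
  · simp
  · simp [Pi.single_apply]

/-- Linear inclusion of `ℝⁿ` into `ℝⁿ⁺¹` as the last coordinates. -/
noncomputable def consL (n : ℕ) : (Fin n → ℝ) →L[ℝ] (Fin (n + 1) → ℝ) :=
  LinearMap.toContinuousLinearMap
    { toFun := fun v => Fin.cons 0 v
      map_add' := fun v w => by
        ext j; refine Fin.cases ?_ (fun j => ?_) j <;> simp
      map_smul' := fun c v => by
        ext j; refine Fin.cases ?_ (fun j => ?_) j <;> simp }

lemma consL_apply {n : ℕ} (v : Fin n → ℝ) : consL n v = Fin.cons 0 v := rfl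

/-- A smooth function with bounded derivatives is recovered from `∏ (1 + ∂_i) f` by convolution
with the exponential kernel. -/
lemma integral_prodKer_mul_opP {n : ℕ} : ∀ {f : (Fin n → ℝ) → ℂ} {S : Set (Fin n → ℝ)} {C : ℝ},
    ContDiff ℝ (⊤ : ℕ∞) f → (∀ i, Pi.single i 1 ∈ S) → (∀ z, DBound S n C f z) →
    ∀ y, ∫ z, (prodKer (y - z) : ℂ) * opP (coordList n) f z = f y := by
  induction n with
  | zero =>
    intro f S C hf hS hC y
    have : (volume : Measure (Fin 0 → ℝ)) = Measure.dirac 0 := by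
      rw [volume_pi, Measure.pi_of_empty _ 0]
    rw [this, integral_dirac]
    simp [prodKer, coordList, Subsingleton.elim y 0]
  | succ n ih =>
    intro f S C hf hS hC y
    set g := opP ((coordList n).map (consL n)) f with hg
    have hLS : ∀ v ∈ (coordList n).map (consL n), v ∈ S := by
      intro v hv
      have : v ∈ coordList (n + 1) := by
        rw [coordList_succ]; exact List.mem_cons_of_mem _ hv
      simp only [coordList, List.mem_map] at this
      obtain ⟨i, -, rfl⟩ := this
      exact hS i
    have hgS : ContDiff ℝ (⊤ : ℕ∞) g := contDiff_opP hf _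
    have hgB : ∀ z, DBound S 1 (2 ^ n * C) g z := by
      intro z
      have := DBound.opP (m := 1) (L := (coordList n).map (consL n))
        ((hC z).mono (by simp [length_coordList]; omega) le_rfl) hf hLS
      simpa [length_coordList] using this
    have hPf : opP (coordList (n + 1)) f = g + dirD (Pi.single 0 1) g := by
      rw [coordList_succ, opP_cons]; rfl
    have hcont : Continuous (g + dirD (Pi.single 0 1) g) :=
      hgS.continuous.add (contDiff_dirD hgS _).continuous
    have hbd : ∀ z, ‖(g + dirD (Pi.single 0 1) g) z‖ ≤ 2 ^ n * C + 2 ^ n * C := fun z =>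
      (norm_add_le _ _).trans (add_le_add (hgB z).norm_le ((hgB z).dirD (hS 0)).norm_le)
    have h_integrable : Integrable fun z => (prodKer (y - z) : ℂ) * (g + dirD (Pi.single 0 1) g) z := by
      refine Integrable.mul_bdd (c := 2 ^ n * C + 2 ^ n * C) ?_ hcont.aestronglyMeasurable
        (Eventually.of_forall hbd)
      exact (integrable_prodKer.comp_sub_left y).ofReal
    rw [hPf]
    have hmp := (volume_preserving_piFinSuccAbove (fun _ : Fin (n + 1) => ℝ) 0).symm
    have hmpe := (MeasurableEquiv.piFinSuccAbove (fun _ : Fin (n + 1) => ℝ) 0).symm.measurableEmbedding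
    rw [← hmp.integral_comp hmpe]
    have h_integrable2 := (hmp.integrable_comp_emb hmpe).2 h_integrable
    have esym : ∀ z : ℝ × (Fin n → ℝ),
        (MeasurableEquiv.piFinSuccAbove (fun _ : Fin (n + 1) => ℝ) 0).symm z = Fin.cons z.1 z.2 := by
      intro z
      exact Fin.insertNth_zero' z.1 z.2
    simp only [Function.comp_def, esym] at h_integrable2 ⊢
    rw [Measure.volume_eq_prod] at h_integrable2 ⊢
    rw [integral_prod_symm _ h_integrable2]
    have hcons : ∀ (s : ℝ) (v : Fin n → ℝ),
        (Fin.cons s v : Fin (n + 1) → ℝ) = Fin.cons s 0 + consL n v := by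
      intro s v
      ext j; refine Fin.cases ?_ (fun j => ?_) j <;> simp [consL_apply]
    have hker : ∀ (s : ℝ) (v : Fin n → ℝ), prodKer (y - Fin.cons s v)
        = expKer (y 0 - s) * prodKer (fun i => y i.succ - v i) := by
      intro s v
      simp [prodKer, Fin.prod_univ_succ]
    have inner : ∀ v : Fin n → ℝ, ∫ s : ℝ, (prodKer (y - Fin.cons s v) : ℂ) *
        (g + dirD (Pi.single 0 1) g) (Fin.cons s v)
        = (prodKer ((fun i => y i.succ) - v) : ℂ) * g (Fin.cons (y 0) v) := by
      intro v
      have hd : ∀ s, HasDerivAt (fun s : ℝ => g (Fin.cons s v))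
          (dirD (Pi.single 0 1) g (Fin.cons s v)) s := by
        intro s
        have h1 : HasDerivAt (fun s : ℝ => (Fin.cons s v : Fin (n + 1) → ℝ)) (Pi.single 0 1) s := by
          rw [hasDerivAt_pi]
          intro j; refine Fin.cases ?_ (fun j => ?_) j
          · simpa using hasDerivAt_id' s
          · simpa using hasDerivAt_const s (v j)
        exact ((hgS.differentiable (by simp)) _).hasFDerivAt.comp_hasDerivAt s h1
      have hcc : Continuous fun s : ℝ => (Fin.cons s v : Fin (n + 1) → ℝ) := by
        refine continuous_pi fun j => ?_
        refine Fin.cases ?_ (fun j => ?_) j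
        · simpa using continuous_id'
        · simpa using continuous_const
      have := integral_expKer_sub_mul hd (C := 2 ^ n * C)
        ((contDiff_dirD hgS _).continuous.comp hcc) (fun s => (hgB _).norm_le)
        (fun s => ((hgB _).dirD (hS 0)).norm_le) (y 0)
      rw [← this, ← integral_const_mul]
      congr 1
      ext s
      rw [hker]
      simp only [Pi.add_apply, Complex.ofReal_mul]
      have : (fun i => y i.succ - v i) = (fun i => y (Fin.succ i)) - v := rfl
      rw [this]; ring
    simp only [inner]
    have key := ih (f := fun v => f (Fin.cons (y 0) 0 + consL n v)) (S := consL n ⁻¹' S) (C := C)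
      (hf.comp (contDiff_const.add (consL n).contDiff)) ?_ ?_ (fun i => y i.succ)
    · rw [opP_comp_affine hf] at key
      simp only [← hcons] at key
      rw [← hg] at key
      rw [key]
      congr 1
      ext j; refine Fin.cases ?_ (fun j => ?_) j <;> simp
    · intro i
      apply hLS
      simp only [List.mem_map, coordList]
      exact ⟨_, ⟨i, List.mem_finRange i, rfl⟩, rfl⟩
    · intro z
      exact DBound.comp_affine _ (consL n) (fun v hv => hv) ((hC _).mono (Nat.le_succ n) le_rfl) hf

end ExponentialKernel

section OscillatoryIntegrals

open Filter Topology

variable {n : ℕ}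

lemma phase_add_left (p : Vec n) (i : Fin n) (τ : ℝ) (x y : Vec n) :
    phase (p + τ • Pi.single i 1) x y =
      Complex.exp (τ * (Complex.I * ((x i - y i : ℝ) : ℂ))) * phase p x y := by
  unfold phase
  rw [← Complex.exp_add]
  congr 1
  have : ∑ k, (p + τ • (Pi.single i 1 : Vec n) : Vec n) k * (x k - y k)
      = τ * (x i - y i) + ∑ k, p k * (x k - y k) := by
    simp only [Pi.add_apply, Pi.smul_apply, smul_eq_mul, add_mul, Finset.sum_add_distrib]
    rw [add_comm]
    congr 1
    rw [Finset.sum_eq_single i]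
    · simp
    · intro b _ hb; simp [hb]
    · simp
  rw [this]
  push_cast
  ring

lemma norm_phase (p x y : Vec n) : ‖phase p x y‖ = 1 := by
  unfold phase; rw [mul_comm]; exact Complex.norm_exp_ofReal_mul_I _

lemma contDiff_phase :
    ContDiff ℝ (⊤ : ℕ∞) (fun z : Vec n × Vec n × Vec n => phase z.2.1 z.1 z.2.2) := by
  unfold phase
  have h : ContDiff ℝ (⊤ : ℕ∞)
      (fun z : Vec n × Vec n × Vec n => ∑ i, z.2.1 i * (z.1 i - z.2.2 i)) := by
    refine ContDiff.sum fun i _ => ?_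
    fun_prop
  exact ContDiff.cexp (contDiff_const.mul (Complex.ofRealCLM.contDiff.comp h))

lemma continuous_phase :
    Continuous (fun z : Vec n × Vec n × Vec n => phase z.2.1 z.1 z.2.2) :=
  contDiff_phase.continuous

lemma hasFDerivAt_phase_right (p x y : Vec n) (i : Fin n) :
    fderiv ℝ (fun y => phase p x y) y (Pi.single i 1) = -(Complex.I * p i) * phase p x y := by
  have h1 : HasFDerivAt (fun y : Vec n => ∑ k, p k * (x k - y k))
      (∑ k, p k • (-(ContinuousLinearMap.proj k : Vec n →L[ℝ] ℝ))) y := by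
    refine HasFDerivAt.fun_sum fun k _ => ?_
    exact ((hasFDerivAt_apply (𝕜 := ℝ) k y).const_sub (x k)).const_mul (p k)
  have h2 := ((Complex.ofRealCLM.hasFDerivAt.comp y h1).const_mul Complex.I).cexp
  have h3 : HasFDerivAt (fun y => phase p x y) _ y := h2
  rw [h3.fderiv]
  simp [phase, Pi.single_apply]
  ring

lemma integral_phase_mul_opP {g : Vec n → ℂ} (hg : ContDiff ℝ (⊤ : ℕ∞) g)
    (hc : HasCompactSupport g) (p x : Vec n) (l : List (Fin n)) :
    ∫ y, phase p x y * opP (l.map fun i => Pi.single i 1) g y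
      = (l.map fun i => 1 + Complex.I * (p i : ℂ)).prod * ∫ y, phase p x y * g y := by
  have hphd : ContDiff ℝ (⊤ : ℕ∞) (fun y => phase p x y) :=
    contDiff_phase.comp (g := fun z : Vec n × Vec n × Vec n => phase z.2.1 z.1 z.2.2)
      (f := fun y : Vec n => (x, p, y)) (by fun_prop)
  induction l with
  | nil => simp
  | cons i l ih =>
    set G := opP (l.map fun i => (Pi.single i 1 : Vec n)) g with hG
    have hGs : ContDiff ℝ (⊤ : ℕ∞) G := contDiff_opP hg _
    have hGc : HasCompactSupport G :=
      hc.mono' ((subset_tsupport _).trans (tsupport_opP_subset g _))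
    have hdc : HasCompactSupport (dirD (Pi.single i 1) G) :=
      hGc.mono' ((subset_tsupport _).trans (tsupport_iterD_subset G [_]))
    have hI : ∀ {φ f : Vec n → ℂ}, Continuous φ → Continuous f → HasCompactSupport f →
        Integrable fun y => φ y * f y := fun hφ hf hcf =>
      (hφ.mul hf).integrable_of_hasCompactSupport hcf.mul_left
    have i1 := hI hphd.continuous hGs.continuous hGc
    have i2 := hI hphd.continuous (contDiff_dirD hGs (Pi.single i 1)).continuous hdc
    have key := integral_mul_fderiv_eq_neg_fderiv_mul_of_integrable (μ := (volume : Measure (Vec n)))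
      (f := fun y => phase p x y) (g := G) (v := Pi.single i 1) ?_ i2 i1
      (fun y _ => (hphd.differentiable (by simp)) y) (fun y _ => (hGs.differentiable (by simp)) y)
    · rw [List.map_cons, opP_cons, List.map_cons, List.prod_cons, mul_assoc, ← ih]
      simp only [Pi.add_apply, mul_add]
      rw [integral_add i1 i2]
      change _ + ∫ y, phase p x y * fderiv ℝ G y (Pi.single i 1) = _
      rw [key, ← integral_neg, add_mul, one_mul, ← integral_const_mul]
      congr 1
      refine integral_congr_ae (Eventually.of_forall fun y => ?_)
      simp only [hasFDerivAt_phase_right]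
      ring
    · simp only [hasFDerivAt_phase_right, mul_assoc]
      exact (i1.const_mul _)

/-- The integrable weight `∏ (1 + s_i²)⁻¹`. -/
noncomputable def decayWeight (s : Vec n) : ℝ := ∏ i, (1 + s i ^ 2)⁻¹

lemma decayWeight_pos (s : Vec n) : 0 < decayWeight s :=
  Finset.prod_pos fun _ _ => by positivity

lemma continuous_decayWeight : Continuous (decayWeight (n := n)) := by
  unfold decayWeight
  refine continuous_finsetProd _ fun i _ => ?_
  exact (by fun_prop : Continuous fun s : Vec n => 1 + s i ^ 2).inv₀ fun s => by positivity

lemma integrable_decayWeight : Integrable (decayWeight (n := n)) :=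
  Integrable.fintype_prod (f := fun (_ : Fin n) (s : ℝ) => (1 + s ^ 2)⁻¹)
    fun _ => integrable_inv_one_add_sq

lemma norm_integral_phase_mul_le {g : Vec n → ℂ} (hg : ContDiff ℝ (⊤ : ℕ∞) g)
    (hc : HasCompactSupport g) (p x : Vec n) :
    ‖∫ y, phase p x y * g y‖ ≤
      decayWeight p * ∫ y, ‖opP (coordList n ++ coordList n) g y‖ := by
  have h := integral_phase_mul_opP hg hc p x (List.finRange n ++ List.finRange n)
  have h1 : ‖((List.finRange n ++ List.finRange n).map fun i => 1 + Complex.I * (p i : ℂ)).prod‖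
      = (decayWeight p)⁻¹ := by
    rw [List.map_append, List.prod_append, ← List.ofFn_eq_map, List.prod_ofFn, decayWeight,
      ← Finset.prod_mul_distrib, norm_prod, ← Finset.prod_inv_distrib]
    refine Finset.prod_congr rfl fun i _ => ?_
    rw [inv_inv, norm_mul, ← sq, ← Complex.normSq_eq_norm_sq, Complex.normSq_apply]
    simp
    ring
  have h2 := norm_integral_le_integral_norm (μ := (volume : Measure (Vec n)))
    (fun y => phase p x y * opP (coordList n ++ coordList n) g y)
  rw [List.map_append] at h
  change ∫ y, phase p x y * opP (coordList n ++ coordList n) g y = _ at h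
  rw [h, norm_mul, h1] at h2
  simp only [norm_mul, norm_phase, one_mul] at h2
  rwa [inv_mul_le_iff₀ (decayWeight_pos p)] at h2

lemma exists_dBound_pi_of_hasCompactSupport (m : ℕ) : ∀ {f : Vec n → ℂ},
    ContDiff ℝ (⊤ : ℕ∞) f → HasCompactSupport f →
    ∃ C, ∀ z, DBound (Set.range fun i => (Pi.single i 1 : Vec n)) m C f z := by
  induction m with
  | zero =>
    intro f hf hc
    obtain ⟨C, hC⟩ := hc.exists_bound_of_continuous hf.continuous
    refine ⟨C, fun z L _ hl => ?_⟩
    obtain rfl : L = [] := List.length_eq_zero_iff.1 (by omega)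
    exact hC z
  | succ m ih =>
    intro f hf hc
    obtain ⟨C0, hC0⟩ := ih hf hc
    have hd : ∀ i : Fin n, ∃ C, ∀ z, DBound (Set.range fun i => (Pi.single i 1 : Vec n)) m C
        (dirD (Pi.single i 1) f) z := fun i => ih (contDiff_dirD hf _)
      (hc.mono' ((subset_tsupport _).trans (tsupport_iterD_subset f [_])))
    choose C hC using hd
    have hCn : ∀ i, 0 ≤ C i := fun i => (hC i 0).nonneg
    have hC0n := (hC0 0).nonneg
    refine ⟨C0 + ∑ i, C i, fun z L hL hl => ?_⟩
    rcases L.eq_nil_or_concat with rfl | ⟨L', v, rfl⟩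
    · exact (hC0 z [] (by simp) (by simp)).trans
        (le_add_of_nonneg_right (Finset.sum_nonneg fun i _ => hCn i))
    · simp only [List.concat_eq_append] at *
      obtain ⟨i, rfl⟩ := hL v (by simp)
      rw [iterD_append]
      refine (hC i z L' (fun w hw => hL w (by simp [hw])) (by simpa using hl)).trans ?_
      exact (Finset.single_le_sum (fun i _ => hCn i) (Finset.mem_univ i)).trans
        (le_add_of_nonneg_left hC0n)

/-- Unit direction in the first slot. -/
noncomputable def e1 (i : Fin n) : Vec n × Vec n × Vec n := (Pi.single i 1, 0, 0)

/-- Unit direction in the second slot. -/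
noncomputable def e2 (i : Fin n) : Vec n × Vec n × Vec n := (0, Pi.single i 1, 0)

/-- Unit direction in the third slot. -/
noncomputable def e3 (i : Fin n) : Vec n × Vec n × Vec n := (0, 0, Pi.single i 1)

/-- The directions adapted to the semiclassical parameter `h`. -/
def dirSet (n : ℕ) (h : ℝ) : Set (Vec n × Vec n × Vec n) :=
  {v | ∃ i, v = e1 i ∨ v = h⁻¹ • e2 i ∨ v = e3 i}

/-- Smooth amplitudes all of whose derivatives are bounded. -/
def NiceAmp (h : ℝ) (c : Vec n × Vec n × Vec n → ℂ) : Prop :=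
  ContDiff ℝ (⊤ : ℕ∞) c ∧ ∀ m, ∃ C, ∀ z, DBound (dirSet n h) m C c z

lemma NiceAmp.add {h : ℝ} {c c' : Vec n × Vec n × Vec n → ℂ} (hc : NiceAmp h c)
    (hc' : NiceAmp h c') : NiceAmp h (c + c') := by
  refine ⟨hc.1.add hc'.1, fun m => ?_⟩
  obtain ⟨C, hC⟩ := hc.2 m
  obtain ⟨C', hC'⟩ := hc'.2 m
  exact ⟨_, fun z => (hC z).add (hC' z) hc.1 hc'.1⟩

lemma NiceAmp.smul {h : ℝ} {c : Vec n × Vec n × Vec n → ℂ} (hc : NiceAmp h c) (r : ℂ) :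
    NiceAmp h (r • c) := by
  refine ⟨hc.1.const_smul r, fun m => ?_⟩
  obtain ⟨C, hC⟩ := hc.2 m
  exact ⟨_, fun z => (hC z).smul hc.1 r⟩

lemma NiceAmp.mul {h : ℝ} {c c' : Vec n × Vec n × Vec n → ℂ} (hc : NiceAmp h c)
    (hc' : NiceAmp h c') : NiceAmp h (c * c') := by
  refine ⟨hc.1.mul hc'.1, fun m => ?_⟩
  obtain ⟨C, hC⟩ := hc.2 m
  obtain ⟨C', hC'⟩ := hc'.2 m
  exact ⟨_, fun z => (hC z).mul (hC' z) hc.1 hc'.1⟩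

lemma NiceAmp.dirD {h : ℝ} {c : Vec n × Vec n × Vec n → ℂ} (hc : NiceAmp h c)
    {v : Vec n × Vec n × Vec n} (hv : v ∈ dirSet n h) : NiceAmp h (dirD v c) := by
  refine ⟨contDiff_dirD hc.1 v, fun m => ?_⟩
  obtain ⟨C, hC⟩ := hc.2 (m + 1)
  exact ⟨C, fun z => (hC z).dirD hv⟩

lemma dirD_e2_eq {h : ℝ} (hh : h ≠ 0) (c : Vec n × Vec n × Vec n → ℂ) (i : Fin n) :
    dirD (e2 i) c = (h : ℂ) • dirD (h⁻¹ • e2 i) c := by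
  rw [dirD_smul_dir]
  ext z
  simp [hh]

lemma NiceAmp.dirD_e2 {h : ℝ} (hh : h ≠ 0) {c : Vec n × Vec n × Vec n → ℂ} (hc : NiceAmp h c)
    (i : Fin n) : NiceAmp h (_root_.dirD (e2 i) c) := by
  rw [dirD_e2_eq hh]
  exact (hc.dirD ⟨i, Or.inr (Or.inl rfl)⟩).smul _

lemma NiceAmp.norm_le {h : ℝ} {c : Vec n × Vec n × Vec n → ℂ} (hc : NiceAmp h c) :
    ∃ C, ∀ z, ‖c z‖ ≤ C := by
  obtain ⟨C, hC⟩ := hc.2 0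
  exact ⟨C, fun z => (hC z).norm_le⟩

/-- The inner oscillatory integral. -/
noncomputable def oscInt (c : Vec n × Vec n × Vec n → ℂ) (u : Vec n → ℂ) (x p : Vec n) : ℂ :=
  ∫ y, c (x, p, y) * phase p x y * u y

lemma integrable_oscInt_integrand {c : Vec n × Vec n × Vec n → ℂ} (hc : Continuous c)
    {u : Vec n → ℂ} (hu : Continuous u) (hcu : HasCompactSupport u) (x p : Vec n) :
    Integrable fun y => c (x, p, y) * phase p x y * u y := by
  refine Continuous.integrable_of_hasCompactSupport ?_ hcu.mul_left
  have h1 : Continuous fun y : Vec n => c (x, p, y) := hc.comp (by fun_prop)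
  have h2 : Continuous fun y : Vec n => phase p x y :=
    continuous_phase.comp (f := fun y : Vec n => (x, p, y)) (by fun_prop)
  exact (h1.mul h2).mul hu

lemma stronglyMeasurable_oscInt {c : Vec n × Vec n × Vec n → ℂ} (hc : Continuous c)
    {u : Vec n → ℂ} (hu : Continuous u) :
    StronglyMeasurable fun w : Vec n × Vec n => oscInt c u w.1 w.2 := by
  have h1 : Continuous fun w : (Vec n × Vec n) × Vec n => c (w.1.1, w.1.2, w.2) :=
    hc.comp (by fun_prop)
  have h2 : Continuous fun w : (Vec n × Vec n) × Vec n => phase w.1.2 w.1.1 w.2 :=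
    continuous_phase.comp (f := fun w : (Vec n × Vec n) × Vec n => (w.1.1, w.1.2, w.2))
      (by fun_prop)
  exact ((h1.mul h2).mul (hu.comp continuous_snd)).stronglyMeasurable.integral_prod_right

lemma exists_norm_oscInt_le {h : ℝ} {c : Vec n × Vec n × Vec n → ℂ} (hc : NiceAmp h c)
    {u : Vec n → ℂ} (hu : ContDiff ℝ (⊤ : ℕ∞) u) (hcu : HasCompactSupport u) :
    ∃ D, 0 ≤ D ∧ ∀ x p, ‖oscInt c u x p‖ ≤ D * decayWeight p := by
  set S := Set.range fun i => (Pi.single i 1 : Vec n)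
  set LL := coordList n ++ coordList n
  obtain ⟨C, hC⟩ := hc.2 LL.length
  obtain ⟨C', hC'⟩ := exists_dBound_pi_of_hasCompactSupport LL.length hu hcu
  set B := 2 ^ LL.length * (2 ^ LL.length * (C * C'))
  have hCn := (hC 0).nonneg
  have hCn' := (hC' 0).nonneg
  refine ⟨B * (volume (tsupport u)).toReal, by positivity, fun x p => ?_⟩
  set inc : Vec n →L[ℝ] Vec n × Vec n × Vec n :=
    (ContinuousLinearMap.inr ℝ _ _).comp (ContinuousLinearMap.inr ℝ _ _)
  have hsl : (fun y : Vec n => c (x, p, y)) = fun y => c ((x, p, 0) + inc y) := by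
    ext y; simp [inc]
  have hcs : ContDiff ℝ (⊤ : ℕ∞) fun y : Vec n => c (x, p, y) := hc.1.comp (by fun_prop)
  have hcb : ∀ y, DBound S LL.length C (fun y : Vec n => c (x, p, y)) y := by
    intro y
    rw [hsl]
    refine DBound.comp_affine _ inc ?_ (hC _) hc.1
    rintro v ⟨i, rfl⟩
    exact ⟨i, Or.inr (Or.inr (by simp [inc, e3]))⟩
  set g : Vec n → ℂ := (fun y : Vec n => c (x, p, y)) * u with hg
  have hgs : ContDiff ℝ (⊤ : ℕ∞) g := hcs.mul hu
  have hgc : HasCompactSupport g := hcu.mul_left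
  have e : oscInt c u x p = ∫ y, phase p x y * g y := by
    unfold oscInt
    congr 1; ext y; simp [hg]; ring
  rw [e]
  refine (norm_integral_phase_mul_le hgs hgc p x).trans ?_
  rw [mul_comm]
  refine mul_le_mul_of_nonneg_right ?_ (decayWeight_pos p).le
  have hL : ∀ v ∈ LL, v ∈ S := by
    intro v hv
    simp only [LL, List.mem_append, coordList, List.mem_map] at hv
    rcases hv with ⟨i, -, rfl⟩ | ⟨i, -, rfl⟩ <;> exact ⟨i, rfl⟩
  have hb : ∀ y, ‖opP LL g y‖ ≤ B := by
    intro y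
    have h1 : DBound S (0 + LL.length) (2 ^ LL.length * (C * C')) g y := by
      rw [zero_add]; exact (hcb y).mul (hC' y) hcs hu
    exact (h1.opP hgs hL).norm_le
  have hz : ∀ y, y ∉ tsupport u → ‖opP LL g y‖ = 0 := by
    intro y hy
    rw [norm_eq_zero]
    refine image_eq_zero_of_notMem_tsupport fun h => hy ?_
    exact tsupport_mul_subset_right (tsupport_opP_subset g LL h)
  have hfin : volume (tsupport u) < ⊤ := hcu.isCompact.measure_lt_top
  rw [← setIntegral_eq_integral_of_forall_compl_eq_zero hz]
  have := norm_setIntegral_le_of_norm_le_const (f := fun y => ‖opP LL g y‖) (C := B) hfin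
    (fun y _ => by simpa using hb y)
  exact (le_abs_self _).trans this

lemma integrable_oscInt {h : ℝ} {c : Vec n × Vec n × Vec n → ℂ} (hc : NiceAmp h c)
    {u : Vec n → ℂ} (hu : ContDiff ℝ (⊤ : ℕ∞) u) (hcu : HasCompactSupport u) (x : Vec n) :
    Integrable fun p => oscInt c u x p := by
  obtain ⟨D, -, hD⟩ := exists_norm_oscInt_le hc hu hcu
  refine Integrable.mono' (integrable_decayWeight.const_mul D) ?_ (Eventually.of_forall fun p => hD x p)
  exact ((stronglyMeasurable_oscInt hc.1.continuous hu.continuous).comp_measurable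
    (measurable_prodMk_left (x := x))).aestronglyMeasurable

lemma hasDerivAt_oscInt_integrand {b : Vec n × Vec n × Vec n → ℂ}
    (hb : ContDiff ℝ (⊤ : ℕ∞) b) (i : Fin n) (w : ℂ) (x p y : Vec n) (τ : ℝ) :
    HasDerivAt
      (fun τ : ℝ => b (x, p + τ • Pi.single i 1, y) * phase (p + τ • Pi.single i 1) x y * w)
      ((dirD (e2 i) b (x, p + τ • Pi.single i 1, y) + Complex.I * ((x i - y i : ℝ) : ℂ) *
        b (x, p + τ • Pi.single i 1, y)) * phase (p + τ • Pi.single i 1) x y * w) τ := by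
  have h0 : HasDerivAt (fun τ : ℝ => ((x, p + τ • Pi.single i 1, y) : Vec n × Vec n × Vec n))
      (e2 i) τ := by
    have h1 : HasDerivAt (fun τ : ℝ => p + τ • (Pi.single i 1 : Vec n)) (Pi.single i 1) τ := by
      simpa using ((hasDerivAt_id' τ).smul_const (Pi.single i 1 : Vec n)).const_add p
    exact (hasDerivAt_const τ x).prodMk (h1.prodMk (hasDerivAt_const τ y))
  have h2 : HasDerivAt (fun τ : ℝ => b (x, p + τ • Pi.single i 1, y))
      (dirD (e2 i) b (x, p + τ • Pi.single i 1, y)) τ :=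
    ((hb.differentiable (by simp)) _).hasFDerivAt.comp_hasDerivAt τ h0
  have h3 : HasDerivAt (fun τ : ℝ => phase (p + τ • Pi.single i 1) x y)
      (Complex.I * ((x i - y i : ℝ) : ℂ) * phase (p + τ • Pi.single i 1) x y) τ := by
    simp only [phase_add_left]
    have h4 : HasDerivAt (fun τ : ℝ => (τ : ℂ) * (Complex.I * ((x i - y i : ℝ) : ℂ)))
        (1 * (Complex.I * ((x i - y i : ℝ) : ℂ))) τ :=
      (HasDerivAt.ofReal_comp (hasDerivAt_id' τ)).mul_const _
    have h5 := h4.cexp.mul_const (phase p x y)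
    refine h5.congr_deriv ?_
    ring
  refine ((h2.mul h3).mul_const w).congr_deriv ?_
  ring

lemma hasLineDerivAt_oscInt {h : ℝ} {b d : Vec n × Vec n × Vec n → ℂ}
    (hb : NiceAmp h b) (hdn : NiceAmp h d) (i : Fin n)
    (hd : ∀ z : Vec n × Vec n × Vec n,
      d z = dirD (e2 i) b z + Complex.I * ((z.1 i - z.2.2 i : ℝ) : ℂ) * b z)
    {u : Vec n → ℂ} (hu : Continuous u) (hcu : HasCompactSupport u) (x p : Vec n) :
    HasLineDerivAt ℝ (fun p => oscInt b u x p) (oscInt d u x p) p (Pi.single i 1) := by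
  obtain ⟨D, hD⟩ := hdn.norm_le
  have hF : ∀ τ : ℝ, Integrable fun y =>
      b (x, p + τ • Pi.single i 1, y) * phase (p + τ • Pi.single i 1) x y * u y := fun τ =>
    integrable_oscInt_integrand hb.1.continuous hu hcu x _
  have hF' : ∀ τ : ℝ, Integrable fun y =>
      d (x, p + τ • Pi.single i 1, y) * phase (p + τ • Pi.single i 1) x y * u y := fun τ =>
    integrable_oscInt_integrand hdn.1.continuous hu hcu x _
  have hbd : ∀ (y : Vec n) (τ : ℝ),
      ‖d (x, p + τ • Pi.single i 1, y) * phase (p + τ • Pi.single i 1) x y * u y‖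
        ≤ D * ‖u y‖ := by
    intro y τ
    rw [norm_mul, norm_mul, norm_phase, mul_one]
    exact mul_le_mul_of_nonneg_right (hD _) (norm_nonneg _)
  have hpt : ∀ (y : Vec n) (τ : ℝ), HasDerivAt
      (fun τ : ℝ => b (x, p + τ • Pi.single i 1, y) * phase (p + τ • Pi.single i 1) x y * u y)
      (d (x, p + τ • Pi.single i 1, y) * phase (p + τ • Pi.single i 1) x y * u y) τ := by
    intro y τ
    refine (hasDerivAt_oscInt_integrand hb.1 i (u y) x p y τ).congr_deriv ?_
    rw [hd]
  have hD' : Integrable fun y => D * ‖u y‖ :=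
    (hu.integrable_of_hasCompactSupport hcu).norm.const_mul D
  have key := (hasDerivAt_integral_of_dominated_loc_of_deriv_le (𝕜 := ℝ)
    (μ := (volume : Measure (Vec n))) (x₀ := (0 : ℝ)) (s := Set.univ) univ_mem
    (Eventually.of_forall fun τ => (hF τ).aestronglyMeasurable) (hF 0)
    (hF' 0).aestronglyMeasurable (Eventually.of_forall fun y τ _ => hbd y τ) hD'
    (Eventually.of_forall fun y τ _ => hpt y τ)).2
  unfold HasLineDerivAt oscInt
  refine key.congr_deriv ?_
  rw [zero_smul, add_zero]

/-- Integration by parts in the momentum variable `p i`. -/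
lemma integral_oscInt_eq {h : ℝ} (hh : h ≠ 0) {b c : Vec n × Vec n × Vec n → ℂ}
    (hb : NiceAmp h b) (hc : NiceAmp h c) (i : Fin n) (θ : ℝ)
    (hbc : ∀ z : Vec n × Vec n × Vec n, b z * (θ + Complex.I * ((z.1 i - z.2.2 i : ℝ) : ℂ)) = c z)
    {u : Vec n → ℂ} (hu : ContDiff ℝ (⊤ : ℕ∞) u) (hcu : HasCompactSupport u) (x : Vec n) :
    ∫ p, oscInt c u x p = ∫ p, oscInt ((θ : ℂ) • b + (-1 : ℂ) • dirD (e2 i) b) u x p := by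
  have hbn' : NiceAmp h ((θ : ℂ) • b + (-1 : ℂ) • dirD (e2 i) b) :=
    (hb.smul _).add ((hb.dirD_e2 hh i).smul _)
  have hb'_apply : ∀ z, ((θ : ℂ) • b + (-1 : ℂ) • dirD (e2 i) b) z
      = θ * b z - dirD (e2 i) b z := by
    intro z; simp [sub_eq_add_neg]
  generalize (θ : ℂ) • b + (-1 : ℂ) • dirD (e2 i) b = b' at hbn' hb'_apply ⊢
  have hdn : NiceAmp h (c + (-1 : ℂ) • b') := hc.add (hbn'.smul _)
  have hd_apply : ∀ z, (c + (-1 : ℂ) • b') z = c z - b' z := by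
    intro z; simp [sub_eq_add_neg]
  generalize c + (-1 : ℂ) • b' = d at hdn hd_apply
  have hsub : ∀ p, oscInt d u x p = oscInt c u x p - oscInt b' u x p := by
    intro p
    unfold oscInt
    rw [← integral_sub (integrable_oscInt_integrand hc.1.continuous hu.continuous hcu x p)
      (integrable_oscInt_integrand hbn'.1.continuous hu.continuous hcu x p)]
    congr 1; ext y
    rw [hd_apply]; ring
  have hder : ∀ p, HasLineDerivAt ℝ (fun p => oscInt b u x p) (oscInt d u x p) p
      (Pi.single i 1) := by
    refine fun p => hasLineDerivAt_oscInt hb hdn i (fun z => ?_) hu.continuous hcu x p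
    rw [hd_apply, hb'_apply, ← hbc]
    ring
  have h_integrable : ∀ {c}, NiceAmp h c → Integrable fun p => oscInt c u x p :=
    fun hc => integrable_oscInt hc hu hcu x
  have key := integral_bilinear_hasLineDerivAt_right_eq_neg_left_of_integrable
    (μ := (volume : Measure (Vec n))) (B := ContinuousLinearMap.mul ℝ ℂ) (v := Pi.single i 1)
    (f := fun _ => (1 : ℂ)) (f' := fun _ => 0) (g := fun p => oscInt b u x p)
    (g' := fun p => oscInt d u x p) (by simp)
    (by simpa only [ContinuousLinearMap.mul_apply', one_mul] using h_integrable hdn)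
    (by simpa only [ContinuousLinearMap.mul_apply', one_mul] using h_integrable hb)
    (fun p _ => by simpa [HasLineDerivAt] using hasDerivAt_const (0 : ℝ) (1 : ℂ))
    (fun p _ => hder p)
  simp only [ContinuousLinearMap.mul_apply', one_mul, zero_mul, integral_zero, neg_zero,
    hsub] at key
  rw [integral_sub (h_integrable hc) (h_integrable hbn'), sub_eq_zero] at key
  exact key

end OscillatoryIntegrals

section NonStationaryPhase

open Filter Topology

variable {n : ℕ}

/-- The functional `(x, p, y) ↦ x_i - y_i`. -/
noncomputable def diffL (i : Fin n) : Vec n × Vec n × Vec n →L[ℝ] ℝ :=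
  (ContinuousLinearMap.proj i).comp (ContinuousLinearMap.fst ℝ (Vec n) (Vec n × Vec n)) -
  (ContinuousLinearMap.proj i).comp ((ContinuousLinearMap.snd ℝ (Vec n) (Vec n)).comp
    (ContinuousLinearMap.snd ℝ (Vec n) (Vec n × Vec n)))

lemma diffL_apply (i : Fin n) (z : Vec n × Vec n × Vec n) : diffL i z = z.1 i - z.2.2 i := rfl

lemma abs_diffL_le (h : ℝ) (i : Fin n) : ∀ v ∈ dirSet n h, |diffL i v| ≤ 1 := by
  rintro v ⟨k, rfl | rfl | rfl⟩ <;> rw [diffL_apply]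
  · simp only [e1, Pi.single_apply]; split_ifs <;> simp
  · simp [e2]
  · simp only [e3, Pi.single_apply]; split_ifs <;> simp

lemma norm_recip_sq {E : Type*} [NormedAddCommGroup E] [NormedSpace ℝ E] (θ : ℝ)
    (T : E →L[ℝ] ℝ) (z : E) : ‖recip θ T z‖ ^ 2 = (θ ^ 2 + T z ^ 2)⁻¹ := by
  rw [recip, norm_inv, inv_pow, ← Complex.normSq_eq_norm_sq, Complex.normSq_apply]
  simp
  ring

lemma norm_recip_le_inv {E : Type*} [NormedAddCommGroup E] [NormedSpace ℝ E] {θ : ℝ}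
    (T : E →L[ℝ] ℝ) (z : E) {r : ℝ} (hr : 0 < r) (h : r ^ 2 ≤ θ ^ 2 + T z ^ 2) :
    ‖recip θ T z‖ ≤ r⁻¹ := by
  refine (sq_le_sq₀ (norm_nonneg _) (by positivity)).1 ?_
  rw [norm_recip_sq, inv_pow]
  exact inv_anti₀ (by positivity) h

lemma niceAmp_recip {θ : ℝ} (hθ : 0 < θ) (h : ℝ) (i : Fin n) : NiceAmp h (recip θ (diffL i)) := by
  refine ⟨contDiff_recip hθ _, fun m => ⟨m.factorial * (1 + θ⁻¹) ^ m * θ⁻¹, fun z => ?_⟩⟩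
  have hz := norm_recip_le_inv (θ := θ) (diffL i) z hθ (by nlinarith [sq_nonneg (diffL i z)])
  refine (dBound_recip hθ (diffL i) (abs_diffL_le h i) hz m).mono le_rfl ?_
  exact mul_le_mul_of_nonneg_left hz (by positivity)

/-- One integration by parts in `p i`, with regularization parameter `θ`. -/
noncomputable def ibpStep (s : ℝ × Fin n) (c : Vec n × Vec n × Vec n → ℂ) :
    Vec n × Vec n × Vec n → ℂ :=
  (s.1 : ℂ) • (c * recip s.1 (diffL s.2)) + (-1 : ℂ) • dirD (e2 s.2) (c * recip s.1 (diffL s.2))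

lemma niceAmp_ibpStep {h : ℝ} (hh : h ≠ 0) {s : ℝ × Fin n} (hs : 0 < s.1)
    {c : Vec n × Vec n × Vec n → ℂ} (hc : NiceAmp h c) : NiceAmp h (ibpStep s c) :=
  have hb := hc.mul (niceAmp_recip hs h s.2)
  (hb.smul _).add ((hb.dirD_e2 hh s.2).smul _)

lemma integral_oscInt_ibpStep {h : ℝ} (hh : h ≠ 0) {s : ℝ × Fin n} (hs : 0 < s.1)
    {c : Vec n × Vec n × Vec n → ℂ} (hc : NiceAmp h c)
    {u : Vec n → ℂ} (hu : ContDiff ℝ (⊤ : ℕ∞) u) (hcu : HasCompactSupport u) (x : Vec n) :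
    ∫ p, oscInt c u x p = ∫ p, oscInt (ibpStep s c) u x p := by
  refine integral_oscInt_eq hh (hc.mul (niceAmp_recip hs h s.2)) hc s.2 s.1 (fun z => ?_) hu hcu x
  have h0 := recip_denom_ne_zero hs (diffL s.2 z)
  rw [Pi.mul_apply, recip, ← diffL_apply, mul_assoc, inv_mul_cancel₀ h0, mul_one]

lemma dBound_ibpStep {h : ℝ} (hh : 0 < h) {s : ℝ × Fin n} (hs : 0 < s.1)
    {c : Vec n × Vec n × Vec n → ℂ} (hc : ContDiff ℝ (⊤ : ℕ∞) c) {m q : ℕ} (hq : m + 1 ≤ q)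
    {C K : ℝ} {z : Vec n × Vec n × Vec n} (hz : ‖recip s.1 (diffL s.2) z‖ ≤ K)
    (hC : DBound (dirSet n h) (m + 1) C c z) :
    DBound (dirSet n h) m ((2 ^ q * (q.factorial * (1 + K) ^ q)) *
      ((s.1 + h) * ‖recip s.1 (diffL s.2) z‖) * C) (ibpStep s c) z := by
  have hK : 0 ≤ K := (norm_nonneg _).trans hz
  have hCn := hC.nonneg
  have hw := contDiff_recip hs (diffL s.2)
  have h1 := hC.mul (dBound_recip hs (diffL s.2) (abs_diffL_le h s.2) hz (m + 1)) hc hw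
  have hcw : ContDiff ℝ (⊤ : ℕ∞) (c * recip s.1 (diffL s.2)) := hc.mul hw
  have h2 := (h1.mono (Nat.le_succ m) le_rfl).smul hcw (s.1 : ℂ)
  have h3 := ((h1.dirD (v := h⁻¹ • e2 s.2) ⟨s.2, Or.inr (Or.inl rfl)⟩).smul
 (contDiff_dirD hcw _) (h : ℂ))
  rw [← dirD_e2_eq hh.ne'] at h3
  have hd : ContDiff ℝ (⊤ : ℕ∞) ((-1 : ℂ) • dirD (e2 s.2) (c * recip s.1 (diffL s.2))) :=
    (contDiff_dirD hcw _).const_smul (-1 : ℂ)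
  refine (h2.add (h3.smul (contDiff_dirD hcw _) (-1)) (hcw.const_smul (s.1 : ℂ)) hd).mono le_rfl ?_
  rw [Complex.norm_real, Complex.norm_real, Real.norm_of_nonneg hh.le, Real.norm_of_nonneg hs.le,
    norm_neg, norm_one, one_mul, ← add_mul]
  have e : (2 : ℝ) ^ (m + 1) * ((m + 1).factorial * (1 + K) ^ (m + 1))
      ≤ 2 ^ q * (q.factorial * (1 + K) ^ q) := by
    gcongr
    · norm_num
    · linarith
  calc (s.1 + h) * (2 ^ (m + 1) * (C * ((m + 1).factorial * (1 + K) ^ (m + 1) *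
        ‖recip s.1 (diffL s.2) z‖)))
      = (2 ^ (m + 1) * ((m + 1).factorial * (1 + K) ^ (m + 1))) *
      ((s.1 + h) * ‖recip s.1 (diffL s.2) z‖) * C := by ring
    _ ≤ _ := by
      gcongr

/-- Iterated integrations by parts. -/
noncomputable def ibpList (l : List (ℝ × Fin n)) (c : Vec n × Vec n × Vec n → ℂ) :
    Vec n × Vec n × Vec n → ℂ := l.foldr ibpStep c

lemma niceAmp_ibpList {h : ℝ} (hh : h ≠ 0) {l : List (ℝ × Fin n)} (hl : ∀ s ∈ l, 0 < s.1)
    {c : Vec n × Vec n × Vec n → ℂ} (hc : NiceAmp h c) : NiceAmp h (ibpList l c) := by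
  induction l with
  | nil => exact hc
  | cons s l ih =>
    exact niceAmp_ibpStep hh (hl s (by simp)) (ih fun t ht => hl t (by simp [ht]))

lemma integral_oscInt_ibpList {h : ℝ} (hh : h ≠ 0) {l : List (ℝ × Fin n)}
    (hl : ∀ s ∈ l, 0 < s.1) {c : Vec n × Vec n × Vec n → ℂ} (hc : NiceAmp h c)
    {u : Vec n → ℂ} (hu : ContDiff ℝ (⊤ : ℕ∞) u) (hcu : HasCompactSupport u) (x : Vec n) :
    ∫ p, oscInt c u x p = ∫ p, oscInt (ibpList l c) u x p := by
  induction l with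
  | nil => rfl
  | cons s l ih =>
    have hl' : ∀ t ∈ l, 0 < t.1 := fun t ht => hl t (by simp [ht])
    rw [ih hl']
    exact integral_oscInt_ibpStep hh (hl s (by simp)) (niceAmp_ibpList hh hl' hc) hu hcu x

lemma dBound_ibpList {h : ℝ} (hh : 0 < h) {l : List (ℝ × Fin n)}
    {c : Vec n × Vec n × Vec n → ℂ} (hc : NiceAmp h c) {q : ℕ}
    {C K : ℝ} {z : Vec n × Vec n × Vec n} : ∀ {m : ℕ}, m + l.length ≤ q → (∀ s ∈ l, 0 < s.1) →
    (∀ s ∈ l, ‖recip s.1 (diffL s.2) z‖ ≤ K) →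
    DBound (dirSet n h) q C c z →
    DBound (dirSet n h) m ((2 ^ q * (q.factorial * (1 + K) ^ q)) ^ l.length *
      (l.map fun s => (s.1 + h) * ‖recip s.1 (diffL s.2) z‖).prod * C) (ibpList l c) z := by
  induction l with
  | nil => intro m hm _ _ hC; simpa [ibpList] using hC.mono (by simpa using hm) le_rfl
  | cons s l ih =>
    intro m hm hl hK hC
    have hl' : ∀ t ∈ l, 0 < t.1 := fun t ht => hl t (by simp [ht])
    have h1 := ih (m := m + 1) (by simp at hm; omega) hl' (fun t ht => hK t (by simp [ht])) hC
    have h2 := dBound_ibpStep hh (hl s (by simp)) (niceAmp_ibpList hh.ne' hl' hc).1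
      (q := q) (by simp at hm; omega) (hK s (by simp)) h1
    refine h2.mono le_rfl (le_of_eq ?_)
    simp only [List.length_cons, List.map_cons, List.prod_cons]
    ring

/-- Non-stationary phase: away from `x_0 = y_0` the amplitude can be replaced by one which gains
powers of `h` and of the distance, and decays in `x - y`. -/
lemma exists_amp_of_separated [NeZero n] (N : ℕ) {δ : ℝ} (hδ : 0 < δ) :
    ∃ B, 0 ≤ B ∧ ∀ h ∈ Set.Ioc (0 : ℝ) 1, ∀ c : Vec n × Vec n × Vec n → ℂ, NiceAmp h c →
      ∀ C r : ℝ, δ ≤ r → (∀ z : Vec n × Vec n × Vec n, DBound (dirSet n h) (N + 4 * n) 0 c z ∨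
        (DBound (dirSet n h) (N + 4 * n) C c z ∧ r ≤ |z.1 0 - z.2.2 0|)) →
      ∃ b, NiceAmp h b ∧
        (∀ u : Vec n → ℂ, ContDiff ℝ (⊤ : ℕ∞) u → HasCompactSupport u → ∀ x,
          ∫ p, oscInt c u x p = ∫ p, oscInt b u x p) ∧
        ∀ z : Vec n × Vec n × Vec n, 0 ≤ C →
          DBound (dirSet n h) (n + n) (B * h ^ N * r⁻¹ ^ N * C * decayWeight (z.1 - z.2.2)) b z := by
  set q := N + 4 * n with hq
  set K := 1 + δ⁻¹ with hK
  set Q : ℝ := 2 ^ q * (q.factorial * (1 + K) ^ q) with hQ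
  have hδ' : 0 < δ⁻¹ := by positivity
  have hQ0 : 0 ≤ Q := by positivity
  refine ⟨Q ^ (N + (n + n)) * (2 ^ N * 2 ^ (n + n)), by positivity, ?_⟩
  intro h hh c hc C r hr hz
  have hr0 : 0 < r := hδ.trans_le hr
  set l : List (ℝ × Fin n) := List.replicate N (h, 0) ++
    ((List.finRange n).map (fun i => ((1 : ℝ), i)) ++ (List.finRange n).map (fun i => ((1 : ℝ), i)))
    with hl
  have hlen : l.length = N + (n + n) := by simp [hl]
  have hpos : ∀ s ∈ l, 0 < s.1 := by
    intro s hs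
    simp only [hl, List.mem_append, List.mem_replicate, List.mem_map] at hs
    rcases hs with ⟨-, rfl⟩ | ⟨i, -, rfl⟩ | ⟨i, -, rfl⟩
    · exact hh.1
    · exact one_pos
    · exact one_pos
  refine ⟨ibpList l c, niceAmp_ibpList hh.1.ne' hpos hc,
    fun u hu hcu x => integral_oscInt_ibpList hh.1.ne' hpos hc hu hcu x, fun z hC => ?_⟩
  have hm : (n + n) + l.length ≤ q := by rw [hlen]; omega
  have hdw := (decayWeight_pos (z.1 - z.2.2)).le
  have hh0 := hh.1.le
  rcases hz z with h0 | ⟨h1, h2⟩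
  · have := dBound_ibpList (K := h⁻¹ + 1) hh.1 hc hm hpos ?_ h0
    · refine this.mono le_rfl ?_
      rw [mul_zero]; positivity
    · intro s hs
      simp only [hl, List.mem_append, List.mem_replicate, List.mem_map] at hs
      have hi : 0 < h⁻¹ := inv_pos.2 hh.1
      rcases hs with ⟨-, rfl⟩ | ⟨i, -, rfl⟩ | ⟨i, -, rfl⟩
      · exact (norm_recip_le_inv (diffL 0) z hh.1 (by simp; positivity)).trans (by linarith)
      · exact (norm_recip_le_inv (diffL i) z one_pos (by simp; positivity)).trans (by simp; linarith)
      · exact (norm_recip_le_inv (diffL i) z one_pos (by simp; positivity)).trans (by simp; linarith)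
  · have hw0 : ‖recip h (diffL 0) z‖ ≤ r⁻¹ := by
      refine norm_recip_le_inv (diffL 0) z hr0 ?_
      rw [diffL_apply, ← sq_abs (z.1 0 - z.2.2 0)]
      nlinarith [sq_nonneg h]
    have hw1 : ∀ i, ‖recip 1 (diffL i) z‖ ≤ 1 := fun i => by
      simpa using norm_recip_le_inv (θ := 1) (diffL i) z one_pos (by simp; positivity)
    have hb := dBound_ibpList (K := K) hh.1 hc hm hpos ?_ h1
    · refine hb.mono le_rfl ?_
      have e1 : ((List.finRange n).map fun i =>
          ((1 : ℝ) + h) * ‖recip 1 (diffL i) z‖).prod ^ 2 ≤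
          2 ^ (n + n) * decayWeight (z.1 - z.2.2) := by
        rw [← List.ofFn_eq_map, List.prod_ofFn, Finset.prod_mul_distrib, Finset.prod_const,
          mul_pow, ← Finset.prod_pow, decayWeight]
        simp only [norm_recip_sq, diffL_apply, one_pow, Pi.sub_apply]
        refine mul_le_mul_of_nonneg_right ?_ (Finset.prod_nonneg fun i _ => by positivity)
        rw [← pow_mul, Finset.card_univ, Fintype.card_fin, mul_two]
        exact pow_le_pow_left₀ (by linarith) (by linarith [hh.2]) _
      have e2 : (l.map fun s => (s.1 + h) * ‖recip s.1 (diffL s.2) z‖).prod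
          ≤ (2 * h * r⁻¹) ^ N * (2 ^ (n + n) * decayWeight (z.1 - z.2.2)) := by
        rw [hl, List.map_append, List.map_append, List.prod_append, List.prod_append, ← sq,
          List.map_map, List.map_replicate, List.prod_replicate]
        refine mul_le_mul ?_ e1 (by positivity) (by positivity)
        refine pow_le_pow_left₀ (by positivity) ?_ _
        rw [two_mul]
        exact mul_le_mul_of_nonneg_left hw0 (by positivity)
      rw [hlen]
      calc Q ^ (N + (n + n)) * (l.map fun s => (s.1 + h) * ‖recip s.1 (diffL s.2) z‖).prod * C
          ≤ Q ^ (N + (n + n)) *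
            ((2 * h * r⁻¹) ^ N * (2 ^ (n + n) * decayWeight (z.1 - z.2.2))) * C := by
            gcongr
        _ = _ := by rw [mul_pow, mul_pow]; ring
    · intro s hs
      simp only [hl, List.mem_append, List.mem_replicate, List.mem_map] at hs
      rcases hs with ⟨-, rfl⟩ | ⟨i, -, rfl⟩ | ⟨i, -, rfl⟩
      · refine hw0.trans ((inv_anti₀ hδ hr).trans (by linarith))
      · exact (hw1 i).trans (by linarith)
      · exact (hw1 i).trans (by linarith)

end NonStationaryPhase

section L2Bound

open Filter Topology

variable {n : ℕ}

lemma integrable_prodKer_sub_mul {w : Vec n → ℂ} (hw : Integrable w) :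
    Integrable (fun q : Vec n × Vec n => (prodKer (q.1 - q.2) : ℂ) * w q.1)
      (volume.prod volume) := by
  have h := (hw.convolution_integrand (ContinuousLinearMap.mul ℝ ℂ)
    (integrable_prodKer.comp_neg.ofReal (𝕜 := ℂ))).swap
  refine h.congr (Eventually.of_forall fun q => ?_)
  simp [mul_comm]

lemma integral_mul_eq_integral_opP_mul {f : Vec n → ℂ} {S : Set (Vec n)} {C : ℝ}
    (hf : ContDiff ℝ (⊤ : ℕ∞) f) (hS : ∀ i, Pi.single i 1 ∈ S) (hC : ∀ z, DBound S (n + n) C f z)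
    {w : Vec n → ℂ} (hw : Integrable w) :
    ∫ y, f y * w y = ∫ z, opP (coordList n) f z * ∫ y, (prodKer (y - z) : ℂ) * w y := by
  have hP : ∀ z, ‖opP (coordList n) f z‖ ≤ 2 ^ n * C := fun z => by
    have := (((hC z).mono (m' := 0 + (coordList n).length) (by simp [coordList]) le_rfl).opP hf
      (by simpa [coordList] using hS)).norm_le
    simpa [coordList] using this
  have hPc := (contDiff_opP hf (coordList n)).continuous
  have h_integrable : Integrable (fun q : Vec n × Vec n =>
      (prodKer (q.1 - q.2) : ℂ) * w q.1 * opP (coordList n) f q.2) (volume.prod volume) :=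
    (integrable_prodKer_sub_mul hw).mul_bdd (c := 2 ^ n * C)
      (hPc.comp continuous_snd).aestronglyMeasurable (Eventually.of_forall fun q => hP q.2)
  calc ∫ y, f y * w y
      = ∫ y, ∫ z, (prodKer (y - z) : ℂ) * w y * opP (coordList n) f z := by
        refine integral_congr_ae (Eventually.of_forall fun y => ?_)
        simp only
        rw [← integral_prodKer_mul_opP hf hS (fun z => (hC z).mono (by omega) le_rfl) y,
          ← integral_mul_const]
        refine integral_congr_ae (Eventually.of_forall fun z => ?_)
        simp only; ring
    _ = ∫ z, ∫ y, (prodKer (y - z) : ℂ) * w y * opP (coordList n) f z := integral_integral_swap h_integrable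
    _ = _ := by
        refine integral_congr_ae (Eventually.of_forall fun z => ?_)
        simp only
        rw [integral_mul_const, mul_comm]

/-- The windowed Fourier transform of `w`, with window `prodKer (· - z)`. -/
noncomputable def winFT (w : Vec n → ℂ) (p z : Vec n) : ℂ :=
  ∫ y, (prodKer (y - z) : ℂ) * (Complex.exp (-(Complex.I * ((∑ i, p i * y i : ℝ) : ℂ))) * w y)

lemma stronglyMeasurable_winFT {w : Vec n → ℂ} (hw : StronglyMeasurable w) :
    StronglyMeasurable fun q : Vec n × Vec n => winFT w q.1 q.2 := by
  have hm : StronglyMeasurable fun q : (Vec n × Vec n) × Vec n => (prodKer (q.2 - q.1.2) : ℂ) *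
      (Complex.exp (-(Complex.I * ((∑ i, q.1.1 i * q.2 i : ℝ) : ℂ))) * w q.2) := by
    refine StronglyMeasurable.mul ?_ (StronglyMeasurable.mul ?_ (hw.comp_measurable measurable_snd))
    · exact (Complex.measurable_ofReal.comp (measurable_prodKer.comp
        (measurable_snd.sub (measurable_snd.comp measurable_fst)))).stronglyMeasurable
    · exact Continuous.stronglyMeasurable (by fun_prop)
  exact hm.integral_prod_right (f := fun (q : Vec n × Vec n) (y : Vec n) => (prodKer (y - q.2) : ℂ) *
      (Complex.exp (-(Complex.I * ((∑ i, q.1 i * y i : ℝ) : ℂ))) * w y))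

lemma lintegral_prodKer_sub (y : Vec n) : ∫⁻ z, ENNReal.ofReal (prodKer (y - z)) = 1 := by
  rw [lintegral_sub_left_eq_self (fun z => ENNReal.ofReal (prodKer z)),
    ← ofReal_integral_eq_lintegral_ofReal integrable_prodKer
      (Eventually.of_forall prodKer_nonneg), integral_prodKer, ENNReal.ofReal_one]

lemma enorm_prodKer_le (s : Vec n) : ‖(prodKer s : ℂ)‖ₑ ^ 2 ≤ ENNReal.ofReal (prodKer s) := by
  rw [← ofReal_norm, Complex.norm_real, Real.norm_of_nonneg (prodKer_nonneg s),
    ← ENNReal.ofReal_pow (prodKer_nonneg s)]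
  exact ENNReal.ofReal_le_ofReal (by nlinarith [prodKer_nonneg s, prodKer_le_one s])

lemma integrable_prodKer_mul {w : Vec n → ℂ} (hw : Integrable w) (z : Vec n) :
    Integrable fun y => (prodKer (y - z) : ℂ) * w y := by
  refine Integrable.mono hw ?_ (Eventually.of_forall fun y => ?_)
  · exact (Complex.measurable_ofReal.comp (measurable_prodKer.comp
      (measurable_id.sub_const z))).aestronglyMeasurable.mul hw.1
  · rw [norm_mul, Complex.norm_real, Real.norm_of_nonneg (prodKer_nonneg _)]
    exact mul_le_of_le_one_left (norm_nonneg _) (prodKer_le_one _)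

lemma lintegral_lintegral_winFT_le {w : Vec n → ℂ} (hwm : StronglyMeasurable w)
    (hw : Integrable w) :
    ∫⁻ p, ∫⁻ z, ‖winFT w p z‖ₑ ^ 2 ≤ ENNReal.ofReal ((2 * π) ^ n) * ∫⁻ y, ‖w y‖ₑ ^ 2 := by
  have hW : Measurable fun q : Vec n × Vec n => ‖winFT w q.1 q.2‖ₑ ^ 2 :=
    (stronglyMeasurable_winFT hwm).measurable.enorm.pow_const 2
  rw [lintegral_lintegral_swap hW.aemeasurable]
  have h1 : ∀ z, ∫⁻ p, ‖winFT w p z‖ₑ ^ 2 ≤ ENNReal.ofReal ((2 * π) ^ n) *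
      ∫⁻ y, ENNReal.ofReal (prodKer (y - z)) * ‖w y‖ₑ ^ 2 := fun z => by
    have := lintegral_enorm_fourier_le (integrable_prodKer_mul hw z)
    refine (lintegral_congr fun p => ?_).trans_le (this.trans (mul_le_mul_right (lintegral_mono fun y => ?_) _))
    · unfold winFT
      congr 2
      refine integral_congr_ae (Eventually.of_forall fun y => ?_)
      simp only; ring
    · simp only
      rw [enorm_mul, mul_pow]
      exact mul_le_mul_left (enorm_prodKer_le _) _
  refine (lintegral_mono h1).trans ?_
  have hm : Measurable fun q : Vec n × Vec n => ENNReal.ofReal (prodKer (q.2 - q.1)) * ‖w q.2‖ₑ ^ 2 :=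
    (ENNReal.measurable_ofReal.comp (measurable_prodKer.comp
      (measurable_snd.sub measurable_fst))).mul
      ((hwm.measurable.comp measurable_snd).enorm.pow_const 2)
  rw [lintegral_const_mul _ hm.lintegral_prod_right', lintegral_lintegral_swap hm.aemeasurable]
  refine mul_le_mul_right (le_of_eq (lintegral_congr fun y => ?_)) _
  have hm' : Measurable fun z => ENNReal.ofReal (prodKer (y - z)) :=
    ENNReal.measurable_ofReal.comp (measurable_prodKer.comp (measurable_const.sub measurable_id))
  simp only
  rw [lintegral_mul_const _ hm', lintegral_prodKer_sub, one_mul]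

lemma integrable_expNeg_mul {w : Vec n → ℂ} (hw : Integrable w) (p : Vec n) :
    Integrable fun y => Complex.exp (-(Complex.I * ((∑ i, p i * y i : ℝ) : ℂ))) * w y := by
  refine hw.bdd_mul (c := 1) (Continuous.aestronglyMeasurable (by fun_prop))
    (Eventually.of_forall fun y => ?_)
  rw [Complex.norm_exp]; simp

lemma integrable_winFT {w : Vec n → ℂ} (hw : Integrable w) (p : Vec n) :
    Integrable fun z => winFT w p z :=
  (integrable_prodKer_sub_mul (integrable_expNeg_mul hw p)).integral_prod_right

lemma phase_eq_mul (p x y : Vec n) : phase p x y =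
    Complex.exp (-(Complex.I * ((∑ i, (-p) i * x i : ℝ) : ℂ))) *
      Complex.exp (-(Complex.I * ((∑ i, p i * y i : ℝ) : ℂ))) := by
  unfold phase
  rw [← Complex.exp_add, ← neg_add, ← mul_add, ← Complex.ofReal_add, ← Finset.sum_add_distrib,
    ← mul_neg, ← Complex.ofReal_neg, ← Finset.sum_neg_distrib]
  congr 4
  ext i
  simp only [Pi.neg_apply]; ring

/-- The inclusion of the third factor. -/
noncomputable def incl3 (n : ℕ) : Vec n →L[ℝ] Vec n × Vec n × Vec n :=
  (ContinuousLinearMap.inr ℝ (Vec n) (Vec n × Vec n)).comp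
    (ContinuousLinearMap.inr ℝ (Vec n) (Vec n))

/-- The inclusion of the first factor. -/
noncomputable def incl1 (n : ℕ) : Vec n →L[ℝ] Vec n × Vec n × Vec n :=
  ContinuousLinearMap.inl ℝ (Vec n) (Vec n × Vec n)

lemma incl3_apply (y : Vec n) : incl3 n y = (0, 0, y) := rfl

lemma incl1_apply (y : Vec n) : incl1 n y = (y, 0, 0) := rfl

lemma enorm_integral_mul_oscInt_le {h : ℝ} {b : Vec n × Vec n × Vec n → ℂ} (hb : NiceAmp h b)
    {A : ℝ} (hA : ∀ z : Vec n × Vec n × Vec n,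
      DBound (dirSet n h) (n + n) (A * decayWeight (z.1 - z.2.2)) b z)
    {u v : Vec n → ℂ} (hu : Integrable u) (hv : Integrable v) (p : Vec n) :
    ‖∫ x, v x * oscInt b u x p‖ₑ ≤ ∫⁻ y, ∫⁻ x,
      ENNReal.ofReal (2 ^ (n + n) * A * decayWeight (x - y)) *
        (‖winFT u p y‖ₑ * ‖winFT v (-p) x‖ₑ) := by
  set E : Vec n → Vec n → ℂ := fun p y => Complex.exp (-(Complex.I * ((∑ i, p i * y i : ℝ) : ℂ)))
    with hE
  set L3 := (coordList n).map (incl3 n) with hL3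
  set L1 := (coordList n).map (incl1 n) with hL1
  set b3 := opP L3 b with hb3
  have hlen3 : L3.length = n := by simp [hL3, coordList]
  have hlen1 : L1.length = n := by simp [hL1, coordList]
  have hmem3 : ∀ v ∈ L3, v ∈ dirSet n h := by
    intro v hv
    simp only [hL3, coordList, List.map_map, List.mem_map, Function.comp] at hv
    obtain ⟨i, -, rfl⟩ := hv
    exact ⟨i, Or.inr (Or.inr rfl)⟩
  have hmem1 : ∀ v ∈ L1, v ∈ dirSet n h := by
    intro v hv
    simp only [hL1, coordList, List.map_map, List.mem_map, Function.comp] at hv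
    obtain ⟨i, -, rfl⟩ := hv
    exact ⟨i, Or.inl rfl⟩
  have hb3s : ContDiff ℝ (⊤ : ℕ∞) b3 := contDiff_opP hb.1 _
  obtain ⟨C, hC⟩ := hb.2 (n + n + n)
  have hC3 : ∀ z, DBound (dirSet n h) (n + n) (2 ^ n * C) b3 z := fun z => by
    have := DBound.opP (L := L3) (m := n + n) (by rw [hlen3]; exact hC z) hb.1 hmem3
    rwa [hlen3] at this
  have hA13 : ∀ z : Vec n × Vec n × Vec n,
      ‖opP L1 b3 z‖ ≤ 2 ^ (n + n) * A * decayWeight (z.1 - z.2.2) := fun z => by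
    have := (DBound.opP (L := L1 ++ L3) (m := 0) (by
      rw [List.length_append, hlen3, hlen1, zero_add]; exact hA z) hb.1 (by
        intro v hv
        rcases List.mem_append.1 hv with hv | hv
        · exact hmem1 v hv
        · exact hmem3 v hv)).norm_le
    rw [opP_append, List.length_append, hlen3, hlen1] at this
    simpa [mul_assoc] using this
  have h3 : ∀ x, oscInt b u x p = E (-p) x * ∫ y, b3 (x, p, y) * winFT u p y := fun x => by
    have key := integral_mul_eq_integral_opP_mul (f := fun y => b ((x, p, 0) + incl3 n y))
      (S := {v | incl3 n v ∈ dirSet n h}) (C := C)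
      (hb.1.comp (contDiff_const.add (incl3 n).contDiff)) (fun i => ⟨i, Or.inr (Or.inr rfl)⟩)
      (fun z => ((hC _).mono (by omega) le_rfl).comp_affine _ _ (fun v hv => hv) hb.1)
      (integrable_expNeg_mul hu p)
    rw [opP_comp_affine hb.1] at key
    simp only [incl3_apply, Prod.mk_add_mk, add_zero, zero_add] at key
    unfold oscInt winFT
    rw [← key, ← integral_const_mul]
    refine integral_congr_ae (Eventually.of_forall fun y => ?_)
    simp only [phase_eq_mul, hE]; ring
  have h1 : ∀ y, ∫ x, b3 (x, p, y) * (E (-p) x * v x)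
      = ∫ x, opP L1 b3 (x, p, y) * winFT v (-p) x := fun y => by
    have key := integral_mul_eq_integral_opP_mul (f := fun x => b3 ((0, p, y) + incl1 n x))
      (S := {v | incl1 n v ∈ dirSet n h}) (C := 2 ^ n * C)
      (hb3s.comp (contDiff_const.add (incl1 n).contDiff)) (fun i => ⟨i, Or.inl rfl⟩)
      (fun z => (hC3 _).comp_affine _ _ (fun v hv => hv) hb3s)
      (integrable_expNeg_mul hv (-p))
    rw [opP_comp_affine hb3s] at key
    simp only [incl1_apply, Prod.mk_add_mk, add_zero, zero_add] at key
    exact key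
  have hswap : ∫ x, v x * oscInt b u x p =
      ∫ y, (∫ x, opP L1 b3 (x, p, y) * winFT v (-p) x) * winFT u p y := by
    have hi : Integrable (fun q : Vec n × Vec n =>
        b3 (q.1, p, q.2) * ((E (-p) q.1 * v q.1) * winFT u p q.2)) (volume.prod volume) := by
      refine ((integrable_expNeg_mul hv (-p)).mul_prod (integrable_winFT hu p)).bdd_mul
        (c := 2 ^ n * C) ?_ (Eventually.of_forall fun q => (hC3 _).norm_le)
      exact (hb3s.continuous.comp (by fun_prop)).aestronglyMeasurable
    calc ∫ x, v x * oscInt b u x p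
        = ∫ x, ∫ y, b3 (x, p, y) * ((E (-p) x * v x) * winFT u p y) := by
          refine integral_congr_ae (Eventually.of_forall fun x => ?_)
          simp only
          rw [h3, ← mul_assoc, ← integral_const_mul]
          refine integral_congr_ae (Eventually.of_forall fun y => ?_)
          simp only; ring
      _ = ∫ y, ∫ x, b3 (x, p, y) * ((E (-p) x * v x) * winFT u p y) := integral_integral_swap hi
      _ = _ := by
          refine integral_congr_ae (Eventually.of_forall fun y => ?_)
          simp only
          rw [← h1, ← integral_mul_const]
          refine integral_congr_ae (Eventually.of_forall fun x => ?_)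
          simp only; ring
  rw [hswap]
  refine (enorm_integral_le_lintegral_enorm _).trans (lintegral_mono fun y => ?_)
  rw [enorm_mul]
  refine (mul_le_mul_left (enorm_integral_le_lintegral_enorm _) _).trans ?_
  rw [← lintegral_mul_const' _ _ (by finiteness)]
  refine lintegral_mono fun x => ?_
  simp only
  rw [enorm_mul, mul_assoc, mul_comm ‖winFT v (-p) x‖ₑ, ← ofReal_norm]
  exact mul_le_mul_left (ENNReal.ofReal_le_ofReal (hA13 (x, p, y))) _

end L2Bound

section Boundedness

open Filter Topology

variable {n : ℕ}

lemma two_mul_enorm_mul_enorm_le (a b : ℂ) {s : ℝ} (hs : 0 < s) :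
    2 * (‖a‖ₑ * ‖b‖ₑ) ≤ ENNReal.ofReal s * ‖a‖ₑ ^ 2 + ENNReal.ofReal s⁻¹ * ‖b‖ₑ ^ 2 := by
  have h2 : (2 : ENNReal) = ENNReal.ofReal 2 := by simp
  have hs' : 0 ≤ s⁻¹ := by positivity
  simp only [← ofReal_norm, h2]
  rw [← ENNReal.ofReal_pow (norm_nonneg _), ← ENNReal.ofReal_pow (norm_nonneg _),
    ← ENNReal.ofReal_mul (norm_nonneg _), ← ENNReal.ofReal_mul (by norm_num),
    ← ENNReal.ofReal_mul hs.le, ← ENNReal.ofReal_mul hs',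
    ← ENNReal.ofReal_add (by positivity) (by positivity)]
  refine ENNReal.ofReal_le_ofReal ?_
  have h : s * ‖a‖ ^ 2 + s⁻¹ * ‖b‖ ^ 2 - 2 * (‖a‖ * ‖b‖) = s⁻¹ * (s * ‖a‖ - ‖b‖) ^ 2 := by
    field_simp; ring
  have : 0 ≤ s⁻¹ * (s * ‖a‖ - ‖b‖) ^ 2 := by positivity
  linarith

lemma lintegral_decayWeight {c : ℝ} (hc : 0 ≤ c) :
    ∫⁻ x : Vec n, ENNReal.ofReal (c * decayWeight x)
      = ENNReal.ofReal (c * ∫ x : Vec n, decayWeight x) := by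
  rw [← integral_const_mul, ofReal_integral_eq_lintegral_ofReal
    (integrable_decayWeight.const_mul c)
    (Eventually.of_forall fun x => mul_nonneg hc (decayWeight_pos x).le)]

lemma lintegral_lintegral_decayWeight {c : ℝ} (hc : 0 ≤ c) {g₁ g₂ : Vec n → ENNReal}
    (h₁ : Measurable g₁) (h₂ : Measurable g₂) :
    ∫⁻ y, ∫⁻ x, ENNReal.ofReal (c * decayWeight (x - y)) * (g₁ y + g₂ x)
      = ENNReal.ofReal (c * ∫ x : Vec n, decayWeight x) * ((∫⁻ y, g₁ y) + ∫⁻ x, g₂ x) := by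
  have hk : Measurable fun q : Vec n × Vec n => ENNReal.ofReal (c * decayWeight (q.2 - q.1)) :=
    ENNReal.measurable_ofReal.comp ((continuous_const.mul (continuous_decayWeight.comp
      (continuous_snd.sub continuous_fst))).measurable)
  have hky : ∀ y, Measurable fun x : Vec n => ENNReal.ofReal (c * decayWeight (x - y)) :=
    fun y =>
    ENNReal.measurable_ofReal.comp ((continuous_const.mul (continuous_decayWeight.comp
      (continuous_id.sub continuous_const))).measurable)
  have hkx : ∀ x, Measurable fun y : Vec n => ENNReal.ofReal (c * decayWeight (x - y)) :=
    fun x =>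
    ENNReal.measurable_ofReal.comp ((continuous_const.mul (continuous_decayWeight.comp
      (continuous_const.sub continuous_id))).measurable)
  have e1 : ∀ y, ∫⁻ x, ENNReal.ofReal (c * decayWeight (x - y)) * (g₁ y + g₂ x)
      = ENNReal.ofReal (c * ∫ x : Vec n, decayWeight x) * g₁ y +
        ∫⁻ x, ENNReal.ofReal (c * decayWeight (x - y)) * g₂ x := fun y => by
    simp only [mul_add]
    rw [lintegral_add_left ((hky y).mul_const _), lintegral_mul_const _ (hky y),
      lintegral_sub_right_eq_self (fun x => ENNReal.ofReal (c * decayWeight x)),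
      lintegral_decayWeight hc]
  simp only [e1]
  rw [lintegral_add_left (h₁.const_mul _), lintegral_const_mul _ h₁,
    lintegral_lintegral_swap (hk.mul (h₂.comp measurable_snd)).aemeasurable, mul_add]
  congr 1
  rw [← lintegral_const_mul _ h₂]
  refine lintegral_congr fun x => ?_
  rw [lintegral_mul_const _ (hkx x),
    lintegral_sub_left_eq_self (fun x => ENNReal.ofReal (c * decayWeight x)),
    lintegral_decayWeight hc]

lemma measurable_winFT_right {w : Vec n → ℂ} (hw : StronglyMeasurable w) (p : Vec n) :
    Measurable fun z => winFT w p z :=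
  ((stronglyMeasurable_winFT hw).comp_measurable
    (by fun_prop : Measurable fun z : Vec n => (p, z))).measurable

lemma two_mul_lintegral_enorm_integral_mul_oscInt_le {h : ℝ} {b : Vec n × Vec n × Vec n → ℂ}
    (hb : NiceAmp h b) {A : ℝ} (hA0 : 0 ≤ A) (hA : ∀ z : Vec n × Vec n × Vec n,
      DBound (dirSet n h) (n + n) (A * decayWeight (z.1 - z.2.2)) b z)
    {u v : Vec n → ℂ} (hum : StronglyMeasurable u) (hu : Integrable u)
    (hvm : StronglyMeasurable v) (hv : Integrable v) {s : ℝ} (hs : 0 < s) :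
    2 * ∫⁻ p, ‖∫ x, v x * oscInt b u x p‖ₑ ≤
      ENNReal.ofReal (2 ^ (n + n) * A * ∫ x : Vec n, decayWeight x) *
        (ENNReal.ofReal ((2 * π) ^ n) *
          (ENNReal.ofReal s * (∫⁻ y, ‖u y‖ₑ ^ 2) + ENNReal.ofReal s⁻¹ * ∫⁻ x, ‖v x‖ₑ ^ 2)) := by
  set c := 2 ^ (n + n) * A with hc
  have hc0 : 0 ≤ c := by positivity
  have hUm : Measurable fun q : Vec n × Vec n => ‖winFT u q.1 q.2‖ₑ ^ 2 :=
    (stronglyMeasurable_winFT hum).measurable.enorm.pow_const 2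
  have hVm : Measurable fun q : Vec n × Vec n => ‖winFT v q.1 q.2‖ₑ ^ 2 :=
    (stronglyMeasurable_winFT hvm).measurable.enorm.pow_const 2
  rw [← lintegral_const_mul' _ _ (by finiteness)]
  calc ∫⁻ p, 2 * ‖∫ x, v x * oscInt b u x p‖ₑ
      ≤ ∫⁻ p, ∫⁻ y, ∫⁻ x, ENNReal.ofReal (c * decayWeight (x - y)) *
          (ENNReal.ofReal s * ‖winFT u p y‖ₑ ^ 2 + ENNReal.ofReal s⁻¹ * ‖winFT v (-p) x‖ₑ ^ 2) := by
        refine lintegral_mono fun p => ?_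
        refine (mul_le_mul_right (enorm_integral_mul_oscInt_le hb hA hu hv p) _).trans ?_
        rw [← lintegral_const_mul' _ _ (by finiteness)]
        refine lintegral_mono fun y => ?_
        rw [← lintegral_const_mul' _ _ (by finiteness)]
        refine lintegral_mono fun x => ?_
        simp only
        rw [mul_left_comm]
        exact mul_le_mul_right (two_mul_enorm_mul_enorm_le _ _ hs) _
    _ = ∫⁻ p, ENNReal.ofReal (c * ∫ x : Vec n, decayWeight x) *
          (ENNReal.ofReal s * (∫⁻ y, ‖winFT u p y‖ₑ ^ 2) +
            ENNReal.ofReal s⁻¹ * ∫⁻ x, ‖winFT v (-p) x‖ₑ ^ 2) := by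
        refine lintegral_congr fun p => ?_
        have m1 : Measurable fun y => ‖winFT u p y‖ₑ ^ 2 :=
          (measurable_winFT_right hum p).enorm.pow_const 2
        have m2 : Measurable fun y => ‖winFT v (-p) y‖ₑ ^ 2 :=
          (measurable_winFT_right hvm (-p)).enorm.pow_const 2
        rw [lintegral_lintegral_decayWeight hc0 (m1.const_mul _) (m2.const_mul _),
          lintegral_const_mul _ m1, lintegral_const_mul _ m2]
    _ ≤ _ := by
        rw [lintegral_const_mul' _ _ (by finiteness)]
        refine mul_le_mul_right ?_ _
        have m1 : Measurable fun p => ∫⁻ y, ‖winFT u p y‖ₑ ^ 2 := hUm.lintegral_prod_right'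
        have m2 : Measurable fun p => ∫⁻ y, ‖winFT v p y‖ₑ ^ 2 := hVm.lintegral_prod_right'
        rw [lintegral_add_left (m1.const_mul _), lintegral_const_mul _ m1,
          lintegral_const_mul' _ _ (by finiteness),
          lintegral_neg_eq_self (fun p => ∫⁻ y, ‖winFT v p y‖ₑ ^ 2), mul_add,
          mul_left_comm, mul_left_comm (ENNReal.ofReal ((2 * π) ^ n)) (ENNReal.ofReal s⁻¹)]
        exact add_le_add (mul_le_mul_right (lintegral_lintegral_winFT_le hum hu) _)
          (mul_le_mul_right (lintegral_lintegral_winFT_le hvm hv) _)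

lemma le_sq_mul_of_forall_two_mul_le {X Y D : ℝ} (hD : 0 ≤ D)
    (h : ∀ s, 0 < s → 2 * X ≤ D * (s * Y + s⁻¹ * X)) : X ≤ D ^ 2 * Y := by
  rcases hD.eq_or_lt with rfl | hD
  · have := h 1 one_pos
    simp at this ⊢; linarith
  · have h1 := h D hD
    have : D * (D * Y + D⁻¹ * X) = D ^ 2 * Y + X := by field_simp
    linarith

lemma ennreal_le_sq_mul_of_forall_two_mul_le {X Y : ENNReal} {D : ℝ} (hX : X ≠ ⊤) (hY : Y ≠ ⊤)
    (hD : 0 ≤ D) (h : ∀ s : ℝ, 0 < s →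
      2 * X ≤ ENNReal.ofReal D * (ENNReal.ofReal s * Y + ENNReal.ofReal s⁻¹ * X)) :
    X ≤ ENNReal.ofReal (D ^ 2) * Y := by
  lift X to NNReal using hX
  lift Y to NNReal using hY
  have := le_sq_mul_of_forall_two_mul_le (X := (X : ℝ)) (Y := (Y : ℝ)) hD fun s hs => by
    have h1 := ENNReal.toReal_mono (by finiteness) (h s hs)
    have hs' : 0 ≤ s⁻¹ := by positivity
    rw [ENNReal.toReal_mul, ENNReal.toReal_mul, ENNReal.toReal_add (by finiteness)
      (by finiteness), ENNReal.toReal_mul, ENNReal.toReal_mul, ENNReal.toReal_ofReal hD,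
      ENNReal.toReal_ofReal hs.le, ENNReal.toReal_ofReal hs'] at h1
    simpa using h1
  have h2 := ENNReal.ofReal_le_ofReal this
  rw [ENNReal.ofReal_mul (by positivity)] at h2
  simpa using h2

/-- The `L²` bound for oscillatory integral operators with an amplitude decaying off the
diagonal. -/
lemma lintegral_enorm_integral_oscInt_le {h : ℝ} {b : Vec n × Vec n × Vec n → ℂ}
    (hb : NiceAmp h b) {A : ℝ} (hA0 : 0 ≤ A) (hA : ∀ z : Vec n × Vec n × Vec n,
      DBound (dirSet n h) (n + n) (A * decayWeight (z.1 - z.2.2)) b z)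
    {u : Vec n → ℂ} (hu : ContDiff ℝ (⊤ : ℕ∞) u) (hcu : HasCompactSupport u) :
    ∫⁻ x, ‖∫ p, oscInt b u x p‖ₑ ^ 2 ≤
      ENNReal.ofReal ((2 ^ (n + n) * A * (∫ x : Vec n, decayWeight x) * (2 * π) ^ n) ^ 2) *
        ∫⁻ y, ‖u y‖ₑ ^ 2 := by
  set D := 2 ^ (n + n) * A * (∫ x : Vec n, decayWeight x) * (2 * π) ^ n with hD
  have hW0 : 0 ≤ ∫ x : Vec n, decayWeight x := integral_nonneg fun x => (decayWeight_pos x).le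
  have hD0 : 0 ≤ D := by positivity
  set f : Vec n → ℂ := fun x => ∫ p, oscInt b u x p with hf
  have hosc := stronglyMeasurable_oscInt hb.1.continuous hu.continuous
  have hfm : StronglyMeasurable f := hosc.integral_prod_right (f := fun x p => oscInt b u x p)
  obtain ⟨K, hK0, hK⟩ := exists_norm_oscInt_le hb hu hcu
  have hfK : ∀ x, ‖f x‖ ≤ K * ∫ p : Vec n, decayWeight p := fun x => by
    rw [← integral_const_mul]
    exact norm_integral_le_of_norm_le (integrable_decayWeight.const_mul K)
      (Eventually.of_forall fun p => hK x p)
  have hui : Integrable u := hu.continuous.integrable_of_hasCompactSupport hcu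
  have hY : ∫⁻ y, ‖u y‖ₑ ^ 2 ≠ ⊤ := by
    have := (hu.continuous.memLp_of_hasCompactSupport (p := 2) (μ := volume) hcu).2
    have h2 := lintegral_rpow_enorm_lt_top_of_eLpNorm_lt_top (by norm_num) (by norm_num) this
    simpa using h2.ne
  have main : ∀ R : ℕ, ∫⁻ x in Metric.closedBall (0 : Vec n) R, ‖f x‖ₑ ^ 2 ≤
      ENNReal.ofReal (D ^ 2) * ∫⁻ y, ‖u y‖ₑ ^ 2 := by
    intro R
    set S := Metric.closedBall (0 : Vec n) R with hS
    have hSm : MeasurableSet S := Metric.isClosed_closedBall.measurableSet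
    have hSf : volume S ≠ ⊤ := (isCompact_closedBall _ _).measure_lt_top.ne
    set v : Vec n → ℂ := S.indicator fun x => (starRingEnd ℂ) (f x) with hv
    have hvm : StronglyMeasurable v :=
      ((Complex.continuous_conj.comp_stronglyMeasurable hfm)).indicator hSm
    have hvi : Integrable v := by
      rw [hv, integrable_indicator_iff hSm]
      exact Measure.integrableOn_of_bounded hSf
        (Complex.continuous_conj.comp_stronglyMeasurable hfm).aestronglyMeasurable
        (Eventually.of_forall fun x => by simpa using hfK x)
    have hvn : ∀ x, ‖v x‖ₑ ^ 2 = S.indicator (fun x => ‖f x‖ₑ ^ 2) x := fun x => by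
      by_cases hx : x ∈ S <;> simp [hv, hx, ← ofReal_norm]
    have hX : ∫⁻ x in S, ‖f x‖ₑ ^ 2 = ∫⁻ x, ‖v x‖ₑ ^ 2 := by
      simp only [hvn]; rw [lintegral_indicator hSm]
    have hXf : ∫⁻ x in S, ‖f x‖ₑ ^ 2 ≠ ⊤ := by
      refine (setLIntegral_lt_top_of_le_nnreal hSf
        ⟨(Real.toNNReal ((K * ∫ p : Vec n, decayWeight p) ^ 2)), fun x _ => ?_⟩).ne
      rw [← ofReal_norm, ← ENNReal.ofReal_pow (norm_nonneg _)]
      exact ENNReal.ofReal_le_ofReal (pow_le_pow_left₀ (norm_nonneg _) (hfK x) 2)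
    have hvf : ∫⁻ x, ‖v x‖ₑ ^ 2 = ‖∫ x, v x * f x‖ₑ := by
      have e : ∀ x, v x * f x = ((‖v x‖ ^ 2 : ℝ) : ℂ) := fun x => by
        by_cases hx : x ∈ S
        · simp [hv, hx, Complex.conj_mul']
        · simp [hv, hx]
      simp only [e]
      have h0 : 0 ≤ ∫ x, ‖v x‖ ^ 2 := integral_nonneg fun x => by positivity
      rw [integral_complex_ofReal, ← ofReal_norm, Complex.norm_real, Real.norm_of_nonneg h0]
      have hi : Integrable fun x => ‖v x‖ ^ 2 := by
        refine ⟨(hvm.norm.pow 2).aestronglyMeasurable, ?_⟩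
        rw [hasFiniteIntegral_iff_enorm]
        simpa [enorm_pow, ← hX] using hXf.lt_top
      rw [ofReal_integral_eq_lintegral_ofReal hi (Eventually.of_forall fun x => by positivity)]
      refine lintegral_congr fun x => ?_
      rw [← ofReal_norm, ENNReal.ofReal_pow (norm_nonneg _)]
    have hfub : ∫ x, v x * f x = ∫ p, ∫ x, v x * oscInt b u x p := by
      have hi : Integrable (fun q : Vec n × Vec n => v q.1 * oscInt b u q.1 q.2)
          (volume.prod volume) := by
        refine Integrable.mono' (hvi.norm.mul_prod (integrable_decayWeight.const_mul K))
          ((hvm.comp_measurable measurable_fst).mul hosc).aestronglyMeasurable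
          (Eventually.of_forall fun q => ?_)
        rw [norm_mul]
        exact mul_le_mul_of_nonneg_left (hK _ _) (norm_nonneg _)
      rw [← integral_integral_swap hi]
      refine integral_congr_ae (Eventually.of_forall fun x => ?_)
      simp only [hf]
      rw [integral_const_mul]
    rw [hX] at hXf ⊢
    have key : ∀ s : ℝ, 0 < s → 2 * ∫⁻ x, ‖v x‖ₑ ^ 2 ≤ ENNReal.ofReal D *
        (ENNReal.ofReal s * (∫⁻ y, ‖u y‖ₑ ^ 2) + ENNReal.ofReal s⁻¹ * ∫⁻ x, ‖v x‖ₑ ^ 2) := by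
      intro s hs
      have h1 := two_mul_lintegral_enorm_integral_mul_oscInt_le hb hA0 hA
        hu.continuous.stronglyMeasurable hui hvm hvi hs
      rw [← mul_assoc, ← ENNReal.ofReal_mul (by positivity)] at h1
      refine le_trans (mul_le_mul_right ?_ _) h1
      rw [hvf, hfub]
      exact enorm_integral_le_lintegral_enorm _
    exact ennreal_le_sq_mul_of_forall_two_mul_le hXf hY hD0 key
  have hmono : ∫⁻ x, ‖f x‖ₑ ^ 2 = ⨆ R : ℕ, ∫⁻ x in Metric.closedBall (0 : Vec n) R, ‖f x‖ₑ ^ 2 := by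
    rw [← setLIntegral_univ, ← Metric.iUnion_closedBall_nat (0 : Vec n)]
    exact setLIntegral_iUnion_of_directed _ (directed_of_isDirected_le fun i j hij =>
      Metric.closedBall_subset_closedBall (by exact_mod_cast hij))
  rw [hmono]
  exact iSup_le main

end Boundedness

section Seminorms

open Filter Topology

variable {n : ℕ}

/-- The list containing the direction `v i` exactly `A i` times. -/
def multiList {E : Type*} (v : Fin n → E) (A : Fin n → ℕ) : List E :=
  (List.finRange n).flatMap fun i => List.replicate (A i) (v i)

lemma coe_multiList {E : Type*} (v : Fin n → E) (A : Fin n → ℕ) :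
    (multiList v A : Multiset E) = ∑ i, A i • ({v i} : Multiset E) := by
  rw [Fin.sum_univ_def]
  unfold multiList
  induction List.finRange n with
  | nil => rfl
  | cons i l ih =>
    rw [List.flatMap_cons, ← Multiset.coe_add, ih, List.map_cons, List.sum_cons,
      Multiset.nsmul_singleton, Multiset.coe_replicate]

lemma multiList_add_single_perm {E : Type*} (v : Fin n → E) (A : Fin n → ℕ) (i : Fin n) :
    (v i :: multiList v A).Perm (multiList v (A + Pi.single i 1)) := by
  rw [← Multiset.coe_eq_coe, ← Multiset.cons_coe, coe_multiList, coe_multiList]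
  simp only [Pi.add_apply, add_smul, Finset.sum_add_distrib]
  rw [add_comm, Finset.sum_eq_single (f := fun x => (Pi.single i 1 : Fin n → ℕ) x • ({v x} : Multiset E)) i (fun b _ hb => by simp [hb]) (by simp),
    Pi.single_eq_same, one_smul, Multiset.singleton_add]

lemma multiList_zero {E : Type*} (v : Fin n → E) : multiList v 0 = [] := by
  simp [multiList]

lemma multiList_map {E F : Type*} (T : E → F) (v : Fin n → E) (A : Fin n → ℕ) :
    (multiList v A).map T = multiList (fun i => T (v i)) A := by
  simp [multiList, List.map_flatMap]

lemma mpd_eq_iterD (A : Fin n → ℕ) (f : Vec n → ℂ) :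
    mpd A f = iterD (multiList (fun i => Pi.single i 1) A) f := by
  unfold mpd multiList
  induction List.finRange n with
  | nil => rfl
  | cons i l ih =>
    rw [List.foldr_cons, ih, List.flatMap_cons, iterD_append]
    generalize iterD _ f = g
    induction A i with
    | zero => rfl
    | succ k ihk => rw [Function.iterate_succ_apply', ihk]; rfl

/-- The inclusion of the second factor. -/
noncomputable def incl2 (n : ℕ) : Vec n →L[ℝ] Vec n × Vec n × Vec n :=
  (ContinuousLinearMap.inr ℝ (Vec n) (Vec n × Vec n)).comp
    (ContinuousLinearMap.inl ℝ (Vec n) (Vec n))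

lemma incl2_apply (y : Vec n) : incl2 n y = (0, y, 0) := rfl

/-- The curried form of a function on phase space. -/
def curry3 (G : Vec n × Vec n × Vec n → ℂ) : Vec n → Vec n → Vec n → ℂ :=
  fun q p q' => G (q, p, q')

lemma d1B_curry3 {G : Vec n × Vec n × Vec n → ℂ} (hG : ContDiff ℝ (⊤ : ℕ∞) G) (A : Fin n → ℕ) :
    d1B A (curry3 G) = curry3 (iterD (multiList e1 A) G) := by
  ext q p q'
  have h := iterD_comp_affine hG (0, p, q') (incl1 n) (multiList (fun i => Pi.single i 1) A)
  rw [multiList_map, ← mpd_eq_iterD] at h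
  have h := congrFun h q
  simp only [incl1_apply, Prod.mk_add_mk, add_zero, zero_add] at h
  exact h

lemma d2B_curry3 {G : Vec n × Vec n × Vec n → ℂ} (hG : ContDiff ℝ (⊤ : ℕ∞) G) (A : Fin n → ℕ) :
    d2B A (curry3 G) = curry3 (iterD (multiList e2 A) G) := by
  ext q p q'
  have h := iterD_comp_affine hG (q, 0, q') (incl2 n) (multiList (fun i => Pi.single i 1) A)
  rw [multiList_map, ← mpd_eq_iterD] at h
  have h := congrFun h p
  simp only [incl2_apply, Prod.mk_add_mk, add_zero, zero_add] at h
  exact h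

lemma d3B_curry3 {G : Vec n × Vec n × Vec n → ℂ} (hG : ContDiff ℝ (⊤ : ℕ∞) G) (A : Fin n → ℕ) :
    d3B A (curry3 G) = curry3 (iterD (multiList e3 A) G) := by
  ext q p q'
  have h := iterD_comp_affine hG (q, p, 0) (incl3 n) (multiList (fun i => Pi.single i 1) A)
  rw [multiList_map, ← mpd_eq_iterD] at h
  have h := congrFun h q'
  simp only [incl3_apply, Prod.mk_add_mk, add_zero, zero_add] at h
  exact h

/-- The diagonal scaling with factors `s i`. -/
noncomputable def diagL (s : Fin n → ℝ) : Vec n →L[ℝ] Vec n :=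
  ContinuousLinearMap.pi fun i => s i • ContinuousLinearMap.proj i

lemma diagL_apply (s : Fin n → ℝ) (x : Vec n) (i : Fin n) : diagL s x i = s i * x i := rfl

lemma diagL_single (s : Fin n → ℝ) (i : Fin n) :
    diagL s (Pi.single i 1) = s i • (Pi.single i 1 : Vec n) := by
  ext j
  rw [diagL_apply]
  by_cases hj : j = i
  · subst hj; simp
  · simp [hj]

/-- The scaling factors which normalise the weight `μ`. -/
noncomputable def wt [NeZero n] (μ : ℝ) (i : Fin n) : ℝ := if i = 0 then 1 else μ⁻¹

lemma wt_pos [NeZero n] {μ : ℝ} (hμ : 0 < μ) (i : Fin n) : 0 < wt μ i := by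
  unfold wt; split_ifs <;> positivity

/-- The rescaling of phase space normalising the weight `μ` and the parameter `h`. -/
noncomputable def resc [NeZero n] (h μ : ℝ) : Vec n × Vec n × Vec n →L[ℝ] Vec n × Vec n × Vec n :=
  (diagL (wt μ)).prodMap ((diagL fun i => h * (wt μ i)⁻¹).prodMap (diagL (wt μ)))

lemma angLen_add_single [NeZero n] (A : Fin n → ℕ) (i : Fin n) :
    angLen (A + Pi.single i 1) = angLen A + if i = 0 then 0 else 1 := by
  unfold angLen
  have : ∀ j : Fin n, (if j = 0 then 0 else (A + Pi.single i 1 : Fin n → ℕ) j)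
      = (if j = 0 then 0 else A j) + (if j = i then (if i = 0 then 0 else 1) else 0) := by
    intro j
    by_cases hji : j = i
    · subst hji; by_cases hj : j = 0 <;> simp [hj]
    · simp [hji]
  rw [Finset.sum_congr rfl fun j _ => this j, Finset.sum_add_distrib]
  simp

lemma fullLen_add_single (A : Fin n → ℕ) (i : Fin n) :
    fullLen (A + Pi.single i 1) = fullLen A + 1 := by
  simp [fullLen, Finset.sum_add_distrib]

lemma wt_eq_zpow [NeZero n] (μ : ℝ) (i : Fin n) :
    wt μ i = μ ^ (-((if i = 0 then 0 else 1 : ℕ) : ℤ)) := by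
  unfold wt; split_ifs <;> simp

lemma exists_iterD_resc_eq [NeZero n] {h μ : ℝ} (hh : h ≠ 0) (hμ : 0 < μ)
    {G : Vec n × Vec n × Vec n → ℂ} (hG : ContDiff ℝ (⊤ : ℕ∞) G)
    (L : List (Vec n × Vec n × Vec n)) (hL : ∀ v ∈ L, v ∈ dirSet n h) :
    ∃ A B A' : Fin n → ℕ, fullLen A + fullLen B + fullLen A' = L.length ∧
      iterD (L.map (resc h μ)) G = ((μ ^ ((angLen B : ℤ) - angLen A - angLen A') : ℝ) : ℂ) •
        iterD (multiList e1 A ++ multiList e2 B ++ multiList e3 A') G := by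
  induction L with
  | nil =>
    refine ⟨0, 0, 0, by simp [fullLen], ?_⟩
    simp [multiList_zero, angLen]
  | cons v L ih =>
    obtain ⟨A, B, A', hlen, heq⟩ := ih fun w hw => hL w (List.mem_cons_of_mem _ hw)
    have hdiff : ∀ L' : List (Vec n × Vec n × Vec n), Differentiable ℝ (iterD L' G) :=
      fun L' => (contDiff_iterD hG L').differentiable (by simp)
    have step : ∀ (c : ℝ) (w : Vec n × Vec n × Vec n) (L' : List (Vec n × Vec n × Vec n)),
        resc h μ v = c • w →
        (w :: (multiList e1 A ++ multiList e2 B ++ multiList e3 A')).Perm L' →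
        iterD ((v :: L).map (resc h μ)) G =
          ((μ ^ ((angLen B : ℤ) - angLen A - angLen A') * c : ℝ) : ℂ) • iterD L' G := by
      intro c w L' hw hp
      rw [List.map_cons, iterD_cons, heq, dirD_smul (hdiff _), hw, dirD_smul_dir, ← iterD_cons,
        iterD_perm hp hG]
      ext z
      simp [mul_assoc]
    obtain ⟨i, rfl | rfl | rfl⟩ := hL v List.mem_cons_self
    · refine ⟨A + Pi.single i 1, B, A', ?_, ?_⟩
      · rw [fullLen_add_single, List.length_cons]; omega
      · rw [step (wt μ i) (e1 i) (multiList e1 (A + Pi.single i 1) ++ multiList e2 B ++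
          multiList e3 A')]
        · congr 2
          rw [wt_eq_zpow, ← zpow_add₀ hμ.ne', angLen_add_single]
          push_cast; congr 1; ring
        · simp [resc, e1, diagL_single]
        · exact ((multiList_add_single_perm e1 A i).append_right _).append_right _
    · refine ⟨A, B + Pi.single i 1, A', ?_, ?_⟩
      · rw [fullLen_add_single, List.length_cons]; omega
      · rw [step ((wt μ i)⁻¹) (e2 i) (multiList e1 A ++ multiList e2 (B + Pi.single i 1) ++
          multiList e3 A')]
        · congr 2
          rw [wt_eq_zpow, ← zpow_neg, ← zpow_add₀ hμ.ne', angLen_add_single]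
          push_cast; congr 1; ring
        · rw [map_smul]
          simp [resc, e2, diagL_single, smul_smul, hh]
        · rw [← List.cons_append]
          refine List.Perm.append_right _ ?_
          exact List.perm_middle.symm.trans ((multiList_add_single_perm e2 B i).append_left _)
    · refine ⟨A, B, A' + Pi.single i 1, ?_, ?_⟩
      · rw [fullLen_add_single, List.length_cons]; omega
      · rw [step (wt μ i) (e3 i) (multiList e1 A ++ multiList e2 B ++
          multiList e3 (A' + Pi.single i 1))]
        · congr 2
          rw [wt_eq_zpow, ← zpow_add₀ hμ.ne', angLen_add_single]
          push_cast; congr 1; ring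
        · simp [resc, e3, diagL_single]
        · exact List.perm_middle.symm.trans ((multiList_add_single_perm e3 A' i).append_left _)

lemma le_iSup_five {ι V : Type*} [Nonempty ι] [Nonempty V] {F : ι → ι → V → V → V → ℝ} {C : ℝ}
    (hF : ∀ j k q p q', F j k q p q' ≤ C) (j k : ι) (q p q' : V) :
    F j k q p q' ≤ ⨆ j, ⨆ k, ⨆ q, ⨆ p, ⨆ q', F j k q p q' := by
  have c1 : ∀ j k q p, (⨆ q', F j k q p q') ≤ C := fun j k q p => ciSup_le fun q' => hF _ _ _ _ q'
  have c2 : ∀ j k q, (⨆ p, ⨆ q', F j k q p q') ≤ C := fun j k q => ciSup_le fun p => c1 _ _ _ p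
  have c3 : ∀ j k, (⨆ q, ⨆ p, ⨆ q', F j k q p q') ≤ C := fun j k => ciSup_le fun q => c2 _ _ q
  have c4 : ∀ j, (⨆ k, ⨆ q, ⨆ p, ⨆ q', F j k q p q') ≤ C := fun j => ciSup_le fun k => c3 _ k
  exact le_ciSup_of_le ⟨C, by rintro _ ⟨x, rfl⟩; exact c4 x⟩ j <|
    le_ciSup_of_le ⟨C, by rintro _ ⟨x, rfl⟩; exact c3 j x⟩ k <|
    le_ciSup_of_le ⟨C, by rintro _ ⟨x, rfl⟩; exact c2 j k x⟩ q <|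
    le_ciSup_of_le ⟨C, by rintro _ ⟨x, rfl⟩; exact c1 j k q x⟩ p <|
    le_ciSup ⟨C, by rintro _ ⟨x, rfl⟩; exact hF j k q p x⟩ q'

lemma bisym_term_le [NeZero n] {lam : ℝ → ℝ} {t : ℝ} {a : Vec n → Vec n → Vec n → ℂ}
    (hlam : ∀ r, 0 < lam r) (ha : IsBisymbol lam 0 0 t a) {M : ℕ} {A B A' : Fin n → ℕ}
    (hM : fullLen A + fullLen B + fullLen A' ≤ M) (j k : ℤ) {q p q' : Vec n}
    (hq : |q 0 - (j : ℝ)| ≤ 1) (hq' : |q' 0 - (k : ℝ)| ≤ 1) :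
    lamT lam t j k ^ ((angLen B : ℤ) - angLen A - angLen A') * ‖d1B A (d2B B (d3B A' a)) q p q'‖
      ≤ bisymSeminorm lam M 0 0 t a := by
  have hμ : ∀ j k : ℤ, 0 < lamT lam t j k := fun j k => hlam _
  have hle : ∀ (A : Fin n → ℕ), fullLen A ≤ M → ∀ i, A i < M + 1 := fun A hA i =>
    Nat.lt_succ_of_le ((Finset.single_le_sum (f := A) (fun _ _ => Nat.zero_le _)
      (Finset.mem_univ i)).trans hA)
  have hA := hle A (by omega)
  have hB := hle B (by omega)
  have hA' := hle A' (by omega)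
  set G : (A B A' : Fin n → ℕ) → ℤ → ℤ → Vec n → Vec n → Vec n → ℝ := fun A B A' j k q p q' =>
    if |q 0 - (j : ℝ)| ≤ 1 ∧ |q' 0 - (k : ℝ)| ≤ 1 then
      jbr (lamT lam t j k) p ^ (-(0 : ℝ) + 0 * (fullLen B : ℝ)) *
        (lamT lam t j k ^ ((angLen B : ℤ) - (angLen A : ℤ) - (angLen A' : ℤ)) *
          ‖d1B A (d2B B (d3B A' a)) q p q'‖)
    else 0 with hG
  have hG0 : ∀ A B A' j k q p q', 0 ≤ G A B A' j k q p q' := by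
    intro A B A' j k q p q'
    simp only [hG]
    split_ifs
    · have := (hμ j k).le
      have h2 : 0 ≤ jbr (lamT lam t j k) p := Real.sqrt_nonneg _
      positivity
    · exact le_rfl
  obtain ⟨C, hC, hbound⟩ := ha.2 A B A'
  have hGC : ∀ j k q p q', G A B A' j k q p q' ≤ C := by
    intro j k q p q'
    simp only [hG]
    split_ifs with hjk
    · simpa using hbound j k q p q' hjk.1 hjk.2
    · exact hC.le
  have h1 : lamT lam t j k ^ ((angLen B : ℤ) - angLen A - angLen A') *
      ‖d1B A (d2B B (d3B A' a)) q p q'‖ = G A B A' j k q p q' := by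
    simp only [hG]
    rw [if_pos ⟨hq, hq'⟩]; simp
  rw [h1]
  refine (le_iSup_five hGC j k q p q').trans ?_
  set H : (A B A' : Fin n → Fin (M + 1)) → ℝ := fun A B A' =>
    if fullLen (fun i => (A i : ℕ)) + fullLen (fun i => (B i : ℕ))
        + fullLen (fun i => (A' i : ℕ)) ≤ M then
      ⨆ j : ℤ, ⨆ k : ℤ, ⨆ q : Vec n, ⨆ p : Vec n, ⨆ q' : Vec n,
        G (fun i => (A i : ℕ)) (fun i => (B i : ℕ)) (fun i => (A' i : ℕ)) j k q p q'
    else 0 with hH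
  have hH0 : ∀ A B A', 0 ≤ H A B A' := by
    intro A B A'
    simp only [hH]
    split_ifs
    · exact Real.iSup_nonneg fun j => Real.iSup_nonneg fun k => Real.iSup_nonneg fun q =>
        Real.iSup_nonneg fun p => Real.iSup_nonneg fun q' => hG0 _ _ _ _ _ _ _ _
    · exact le_rfl
  have hsum : bisymSeminorm lam M 0 0 t a = ∑ A, ∑ B, ∑ A', H A B A' := rfl
  have h2 : (⨆ j : ℤ, ⨆ k : ℤ, ⨆ q : Vec n, ⨆ p : Vec n, ⨆ q' : Vec n, G A B A' j k q p q')
      = H (fun i => ⟨A i, hA i⟩) (fun i => ⟨B i, hB i⟩) (fun i => ⟨A' i, hA' i⟩) := by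
    simp only [hH]
    rw [if_pos hM]
  rw [h2, hsum]
  refine le_trans ?_ (Finset.single_le_sum (f := fun A => ∑ B, ∑ A', H A B A')
    (fun A _ => Finset.sum_nonneg fun B _ => Finset.sum_nonneg fun A' _ => hH0 A B A')
    (Finset.mem_univ (fun i => ⟨A i, hA i⟩)))
  refine le_trans ?_ (Finset.single_le_sum (f := fun B => ∑ A', H (fun i => ⟨A i, hA i⟩) B A')
    (fun B _ => Finset.sum_nonneg fun A' _ => hH0 _ B A')
    (Finset.mem_univ (fun i => ⟨B i, hB i⟩)))
  exact Finset.single_le_sum (f := fun A' => H (fun i => ⟨A i, hA i⟩) (fun i => ⟨B i, hB i⟩) A')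
    (fun A' _ => hH0 _ _ A') (Finset.mem_univ (fun i => (⟨A' i, hA' i⟩ : Fin (M + 1))))

lemma dBound_comp_resc [NeZero n] {lam : ℝ → ℝ} {t : ℝ} {a : Vec n → Vec n → Vec n → ℂ}
    (hlam : ∀ r, 0 < lam r) (ha : IsBisymbol lam 0 0 t a) (M : ℕ) (j k : ℤ) {h : ℝ} (hh : h ≠ 0)
    {z : Vec n × Vec n × Vec n} (hq : |z.1 0 - (j : ℝ)| ≤ 1) (hq' : |z.2.2 0 - (k : ℝ)| ≤ 1) :
    DBound (dirSet n h) M (bisymSeminorm lam M 0 0 t a)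
      (fun z => a (resc h (lamT lam t j k) z).1 (resc h (lamT lam t j k) z).2.1
        (resc h (lamT lam t j k) z).2.2) z := by
  intro L hL hlen
  set μ := lamT lam t j k
  have hμ : 0 < μ := hlam _
  set G : Vec n × Vec n × Vec n → ℂ := fun x => a x.1 x.2.1 x.2.2 with hG
  have e := iterD_comp_affine ha.1 0 (resc h μ) L
  simp only [zero_add] at e
  rw [e]
  obtain ⟨A, B, A', hl, heq⟩ := exists_iterD_resc_eq hh hμ ha.1 L hL
  rw [heq, iterD_append, iterD_append]
  beta_reduce
  rw [Pi.smul_apply, norm_smul, Complex.norm_real,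
    Real.norm_of_nonneg (by positivity)]
  have h3 := d3B_curry3 ha.1 A'
  have h2 := d2B_curry3 (contDiff_iterD ha.1 (multiList e3 A')) B
  have h1 := d1B_curry3 (contDiff_iterD (contDiff_iterD ha.1 (multiList e3 A')) (multiList e2 B)) A
  rw [← h2, ← h3] at h1
  have hz0 : ∀ x : Vec n, diagL (wt μ) x 0 = x 0 := fun x => by simp [diagL_apply, wt]
  have key := bisym_term_le (p := (resc h μ z).2.1) hlam ha (hl.le.trans hlen) j k
    (q := (resc h μ z).1) (q' := (resc h μ z).2.2)
    (by simpa [resc, hz0] using hq) (by simpa [resc, hz0] using hq')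
  refine le_trans (le_of_eq ?_) key
  congr 2
  exact (congrFun (congrFun (congrFun h1 _) _) _).symm

end Seminorms

section Localization

open Filter Topology

variable {n : ℕ}

/-- The first coordinate of the first factor. -/
noncomputable def radL1 (n : ℕ) [NeZero n] : Vec n × Vec n × Vec n →L[ℝ] ℝ :=
  (ContinuousLinearMap.proj (0 : Fin n)).comp (ContinuousLinearMap.fst ℝ (Vec n) (Vec n × Vec n))

/-- The first coordinate of the third factor. -/
noncomputable def radL3 (n : ℕ) [NeZero n] : Vec n × Vec n × Vec n →L[ℝ] ℝ :=
  (ContinuousLinearMap.proj (0 : Fin n)).comp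
    ((ContinuousLinearMap.snd ℝ (Vec n) (Vec n)).comp
      (ContinuousLinearMap.snd ℝ (Vec n) (Vec n × Vec n)))

lemma radL1_apply [NeZero n] (z : Vec n × Vec n × Vec n) : radL1 n z = z.1 0 := rfl

lemma radL3_apply [NeZero n] (z : Vec n × Vec n × Vec n) : radL3 n z = z.2.2 0 := rfl

lemma radL1_mem [NeZero n] (h : ℝ) : ∀ v ∈ dirSet n h, radL1 n v ∈ Metric.closedBall (0 : ℝ) 1 := by
  rintro v ⟨i, rfl | rfl | rfl⟩ <;> rw [radL1_apply] <;> simp [e1, e2, e3]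
  by_cases hi : i = 0
  · subst hi; simp
  · simp [Ne.symm hi]

lemma radL3_mem [NeZero n] (h : ℝ) : ∀ v ∈ dirSet n h, radL3 n v ∈ Metric.closedBall (0 : ℝ) 1 := by
  rintro v ⟨i, rfl | rfl | rfl⟩ <;> rw [radL3_apply] <;> simp [e1, e2, e3]
  by_cases hi : i = 0
  · subst hi; simp
  · simp [Ne.symm hi]

/-- An amplitude localised radially near `j` in the first and near `k` in the third variable. -/
noncomputable def cutAmp [NeZero n] (f : ℝ → ℂ) (j k : ℝ) (g : Vec n × Vec n × Vec n → ℂ) :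
    Vec n × Vec n × Vec n → ℂ :=
  ((fun z => f (-j + radL1 n z)) * fun z => f (-k + radL3 n z)) * g

lemma cutAmp_apply [NeZero n] (f : ℝ → ℂ) (j k : ℝ) (g : Vec n × Vec n × Vec n → ℂ)
    (z : Vec n × Vec n × Vec n) :
    cutAmp f j k g z = f (-j + z.1 0) * f (-k + z.2.2 0) * g z := rfl

lemma contDiff_cutAmp [NeZero n] {f : ℝ → ℂ} (hf : ContDiff ℝ (⊤ : ℕ∞) f) (j k : ℝ)
    {g : Vec n × Vec n × Vec n → ℂ} (hg : ContDiff ℝ (⊤ : ℕ∞) g) :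
    ContDiff ℝ (⊤ : ℕ∞) (cutAmp f j k g) :=
  ((hf.comp (contDiff_const.add (radL1 n).contDiff)).mul
    (hf.comp (contDiff_const.add (radL3 n).contDiff))).mul hg

lemma mem_tsupport_of_mem_tsupport_cutAmp [NeZero n] {f : ℝ → ℂ} {j k : ℝ}
    {g : Vec n × Vec n × Vec n → ℂ} {z : Vec n × Vec n × Vec n}
    (hz : z ∈ tsupport (cutAmp f j k g)) :
    -j + z.1 0 ∈ tsupport f ∧ -k + z.2.2 0 ∈ tsupport f := by
  have hcl : IsClosed {z : Vec n × Vec n × Vec n |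
      -j + z.1 0 ∈ tsupport f ∧ -k + z.2.2 0 ∈ tsupport f} :=
    ((isClosed_tsupport f).preimage (by fun_prop : Continuous fun z : Vec n × Vec n × Vec n => -j + z.1 0)).inter
      ((isClosed_tsupport f).preimage (by fun_prop : Continuous fun z : Vec n × Vec n × Vec n => -k + z.2.2 0))
  refine closure_minimal ?_ hcl hz
  intro w hw
  rw [Function.mem_support, cutAmp_apply] at hw
  exact ⟨subset_tsupport f fun h0 => hw (by simp [h0]), subset_tsupport f fun h0 => hw (by simp [h0])⟩

lemma exists_dBound_cutAmp [NeZero n] {f : ℝ → ℂ} (hf : ContDiff ℝ (⊤ : ℕ∞) f)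
    (hc : HasCompactSupport f) (m : ℕ) :
    ∃ K, 0 ≤ K ∧ ∀ (h j k C : ℝ) (g : Vec n × Vec n × Vec n → ℂ), ContDiff ℝ (⊤ : ℕ∞) g →
      (∀ z : Vec n × Vec n × Vec n, -j + z.1 0 ∈ tsupport f → -k + z.2.2 0 ∈ tsupport f →
        DBound (dirSet n h) m C g z) →
      ∀ z, DBound (dirSet n h) m 0 (cutAmp f j k g) z ∨
        (DBound (dirSet n h) m (K * C) (cutAmp f j k g) z ∧
          -j + z.1 0 ∈ tsupport f ∧ -k + z.2.2 0 ∈ tsupport f) := by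
  obtain ⟨Cf, hCf, hb⟩ := exists_dBound_of_hasCompactSupport hf hc m
  refine ⟨2 ^ m * (2 ^ m * (Cf * Cf)), by positivity, ?_⟩
  intro h j k C g hg hgb z
  by_cases hz : z ∈ tsupport (cutAmp f j k g)
  · right
    have hs := mem_tsupport_of_mem_tsupport_cutAmp hz
    refine ⟨?_, hs⟩
    have h1 := DBound.comp_affine (-j) (radL1 n) (radL1_mem h) (hb (-j + radL1 n z)) hf
    have h2 := DBound.comp_affine (-k) (radL3 n) (radL3_mem h) (hb (-k + radL3 n z)) hf
    have c1 : ContDiff ℝ (⊤ : ℕ∞) (fun z => f (-j + radL1 n z)) :=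
      hf.comp (contDiff_const.add (radL1 n).contDiff)
    have c2 : ContDiff ℝ (⊤ : ℕ∞) (fun z => f (-k + radL3 n z)) :=
      hf.comp (contDiff_const.add (radL3 n).contDiff)
    have h3 := (h1.mul h2 c1 c2).mul (hgb z hs.1 hs.2) (c1.mul c2) hg
    rw [mul_assoc]
    exact h3
  · exact Or.inl (dBound_zero_of_notMem_tsupport hz _ _)

lemma exists_margin {f : ℝ → ℂ} (hc : HasCompactSupport f)
    (hs : tsupport f ⊆ Set.Ioo (-1) 1) :
    ∃ δ : ℝ, 0 < δ ∧ δ ≤ 1 ∧ ∀ x ∈ tsupport f, |x| ≤ 1 - δ := by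
  obtain ⟨a, ha, hK⟩ := IsCompact.exists_forall_le' (s := tsupport f) hc
    (f := fun x : ℝ => 1 - |x|) (by fun_prop) (a := 0) (fun x hx => by
      have := hs hx
      rw [sub_pos, abs_lt]; exact this)
  refine ⟨min a 1, lt_min ha one_pos, min_le_right _ _, fun x hx => ?_⟩
  have := hK x hx
  have := min_le_left a 1
  linarith

lemma le_abs_sub_of_margin {δ : ℝ} (hδ1 : δ ≤ 1) (hδ : 0 < δ) {j k : ℤ} (hjk : 2 ≤ |j - k|) {x y : ℝ}
    (hx : |-(j : ℝ) + x| ≤ 1 - δ) (hy : |-(k : ℝ) + y| ≤ 1 - δ) :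
    δ / 2 * √(1 + ((j : ℝ) - k) ^ 2) ≤ |x - y| := by
  have hd : (2 : ℝ) ≤ |(j : ℝ) - k| := by exact_mod_cast hjk
  have h1 : √(1 + ((j : ℝ) - k) ^ 2) ≤ 2 * |(j : ℝ) - k| := by
    rw [Real.sqrt_le_iff]
    refine ⟨by positivity, ?_⟩
    rw [mul_pow, sq_abs]
    have := sq_abs ((j : ℝ) - k)
    nlinarith
  have h2 : |(j : ℝ) - k| ≤ |x - y| + 2 * (1 - δ) := by
    have : (j : ℝ) - k = (x - y) - (-(j : ℝ) + x) + (-(k : ℝ) + y) := by ring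
    rw [this]
    have := abs_add_le ((x - y) - (-(j : ℝ) + x)) (-(k : ℝ) + y)
    have := abs_sub (x - y) (-(j : ℝ) + x)
    linarith
  nlinarith

lemma hasCompactSupport_comp_diagL {s : Fin n → ℝ} (hs : ∀ i, s i ≠ 0) {u : Vec n → ℂ}
    (hu : HasCompactSupport u) : HasCompactSupport fun y => u (diagL s y) := by
  have hinv : ∀ y, diagL (fun i => (s i)⁻¹) (diagL s y) = y := fun y => by
    ext i; simp [diagL_apply, hs i]
  refine HasCompactSupport.intro (hu.isCompact.image (diagL fun i => (s i)⁻¹).continuous) ?_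
  intro x hx
  by_contra h0
  exact hx ⟨diagL s x, subset_tsupport u h0, hinv x⟩

lemma oph_cut_diagL [NeZero n] (f : ℝ → ℂ) (j k : ℝ) (h : ℝ) {μ : ℝ} (hμ : 0 < μ)
    (a : Vec n → Vec n → Vec n → ℂ) (u : Vec n → ℂ) (x : Vec n) :
    f (-j + diagL (wt μ) x 0) *
        Oph h a (fun q' => f (-k + q' 0) * u q') (diagL (wt μ) x) =
      (((2 * π) ^ (-(n : ℤ)) : ℝ) : ℂ) * ∫ p, oscInt (cutAmp f j k fun z =>
        a (resc h μ z).1 (resc h μ z).2.1 (resc h μ z).2.2) (fun y => u (diagL (wt μ) y)) x p := by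
  set s := wt (n := n) μ with hs
  have hs0 : ∀ i, s i ≠ 0 := fun i => (wt_pos hμ i).ne'
  have hz0 : ∀ x : Vec n, diagL s x 0 = x 0 := fun x => by simp [diagL_apply, hs, wt]
  unfold Oph Op
  rw [mul_left_comm]
  congr 1
  rw [integral_comp_mul_pi (s := fun i => (s i)⁻¹) (fun i => inv_ne_zero (hs0 i))]
  rw [← integral_smul, ← integral_const_mul]
  refine integral_congr_ae (Eventually.of_forall fun p => ?_)
  beta_reduce
  rw [integral_comp_mul_pi hs0, smul_smul, ← abs_mul, ← Finset.prod_mul_distrib]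
  simp only [inv_mul_cancel₀ (hs0 _), Finset.prod_const_one, abs_one, one_smul]
  rw [← integral_const_mul]
  unfold oscInt
  refine integral_congr_ae (Eventually.of_forall fun y => ?_)
  have hph : phase (fun i => (s i)⁻¹ * p i) (diagL s x) (fun i => s i * y i) = phase p x y := by
    unfold phase
    have : ∀ i, (s i)⁻¹ * p i * (diagL s x i - s i * y i) = p i * (x i - y i) := by
      intro i
      rw [diagL_apply]
      have := hs0 i
      field_simp
    simp only [this]
  have hp : (h • fun i => (s i)⁻¹ * p i : Vec n) = diagL (fun i => h * (s i)⁻¹) p := by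
    ext i; simp [diagL_apply, mul_assoc]
  have hy : (fun i => s i * y i : Vec n) = diagL s y := rfl
  beta_reduce
  have hresc : resc h μ (x, p, y) = (diagL s x, diagL (fun i => h * (s i)⁻¹) p, diagL s y) := rfl
  rw [hph, hp, hy, hz0, ← diagL_apply, hz0, cutAmp_apply, hresc]
  ring

end Localization

section Assembly

open Filter Topology

variable {n : ℕ}

lemma L2_le_of_lintegral_le {F v : Vec n → ℂ} {D : ℝ} (hD : 0 ≤ D)
    (hv : ContDiff ℝ (⊤ : ℕ∞) v) (hcv : HasCompactSupport v)
    (h : ∫⁻ x, ‖F x‖ₑ ^ 2 ≤ ENNReal.ofReal (D ^ 2) * ∫⁻ x, ‖v x‖ₑ ^ 2) :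
    L2 F ≤ D * L2 v := by
  have conv : ∀ (G : Vec n → ℂ), Integrable (fun x => ‖G x‖ ^ 2) →
      ENNReal.ofReal (∫ x, ‖G x‖ ^ 2) = ∫⁻ x, ‖G x‖ₑ ^ 2 := by
    intro G hG
    rw [ofReal_integral_eq_lintegral_ofReal hG (Eventually.of_forall fun x => sq_nonneg _)]
    refine lintegral_congr fun x => ?_
    rw [ENNReal.ofReal_pow (norm_nonneg _), ofReal_norm]
  have hvi : Integrable (fun x => ‖v x‖ ^ 2) := by
    refine Continuous.integrable_of_hasCompactSupport (hv.continuous.norm.pow 2) ?_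
    exact HasCompactSupport.intro hcv fun x hx => by
      simp [image_eq_zero_of_notMem_tsupport hx]
  by_cases hF : Integrable (fun x => ‖F x‖ ^ 2)
  · rw [← conv F hF, ← conv v hvi, ← ENNReal.ofReal_mul (sq_nonneg D)] at h
    have hvn : 0 ≤ ∫ x, ‖v x‖ ^ 2 := integral_nonneg fun x => sq_nonneg _
    rw [ENNReal.ofReal_le_ofReal_iff (by positivity)] at h
    unfold L2
    calc √(∫ x, ‖F x‖ ^ 2) ≤ √(D ^ 2 * ∫ x, ‖v x‖ ^ 2) := Real.sqrt_le_sqrt h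
      _ = D * √(∫ x, ‖v x‖ ^ 2) := by rw [Real.sqrt_mul (sq_nonneg D), Real.sqrt_sq hD]
  · unfold L2
    rw [integral_undef hF, Real.sqrt_zero]
    positivity

lemma lintegral_enorm_diagL {s : Fin n → ℝ} (hs : ∀ i, s i ≠ 0) (F : Vec n → ℂ) :
    ∫⁻ x, ‖F x‖ₑ ^ 2 = ENNReal.ofReal |∏ i, s i| * ∫⁻ x, ‖F (diagL s x)‖ₑ ^ 2 :=
  lintegral_comp_mul_pi hs _

lemma bisymSeminorm_nonneg [NeZero n] {lam : ℝ → ℝ} {t : ℝ} {a : Vec n → Vec n → Vec n → ℂ}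
    (hlam : ∀ r, 0 < lam r) (M : ℕ) : 0 ≤ bisymSeminorm lam M 0 0 t a := by
  unfold bisymSeminorm
  refine Finset.sum_nonneg fun A _ => Finset.sum_nonneg fun B _ => Finset.sum_nonneg fun A' _ => ?_
  split_ifs
  · refine Real.iSup_nonneg fun j => Real.iSup_nonneg fun k => Real.iSup_nonneg fun q =>
      Real.iSup_nonneg fun p => Real.iSup_nonneg fun q' => ?_
    split_ifs
    · have h1 : 0 < lamT lam t j k := hlam _
      have h2 : 0 ≤ jbr (lamT lam t j k) p := Real.sqrt_nonneg _
      positivity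
    · exact le_rfl
  · exact le_rfl

end Assembly

lemma exists_L2_cut_oph_cut_le {n : ℕ} [NeZero n] {lam : ℝ → ℝ} (hlam : ∀ r, 0 < lam r)
    {f : ℝ → ℂ} (hf : ContDiff ℝ (⊤ : ℕ∞) f) (hfs : tsupport f ⊆ Set.Ioo (-1 : ℝ) 1) (N : ℕ) :
    ∃ C, 0 ≤ C ∧ ∃ M : ℕ, ∀ t : ℝ,
      ∀ a : Vec n → Vec n → Vec n → ℂ, IsBisymbol lam 0 0 t a →
        ∀ j k : ℤ, 2 ≤ |j - k| → ∀ h ∈ Set.Ioc (0 : ℝ) 1,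
          ∀ u : Vec n → ℂ, ContDiff ℝ (⊤ : ℕ∞) u → HasCompactSupport u →
            L2 (fun q => f (-(j : ℝ) + q 0) * Oph h a (fun q' => f (-(k : ℝ) + q' 0) * u q') q)
              ≤ C * h ^ N * Real.sqrt (1 + ((j : ℝ) - k) ^ 2) ^ (-(N : ℤ)) *
                  bisymSeminorm lam M 0 0 t a * L2 u := by
  have hc : HasCompactSupport f :=
    isCompact_Icc.of_isClosed_subset (isClosed_tsupport f) (hfs.trans Set.Ioo_subset_Icc_self)
  obtain ⟨δ, hδ, hδ1, hmargin⟩ := exists_margin hc hfs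
  obtain ⟨B, hB, hamp⟩ := exists_amp_of_separated (n := n) N (half_pos hδ)
  set M := N + 4 * n with hM
  obtain ⟨K, hK, hcut⟩ := exists_dBound_cutAmp (n := n) hf hc M
  set W := ∫ x : Vec n, decayWeight x with hW
  have hW0 : 0 ≤ W := integral_nonneg fun x => (decayWeight_pos x).le
  refine ⟨2 ^ (n + n) * B * (δ / 2)⁻¹ ^ N * K * W, by positivity, M, ?_⟩
  intro t a ha j k hjk h hh u hu hcu
  set μ := lamT lam t j k with hμdef
  have hμ : 0 < μ := hlam _
  set J := √(1 + ((j : ℝ) - k) ^ 2) with hJ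
  have hJ1 : 1 ≤ J := by rw [hJ, Real.one_le_sqrt]; nlinarith [sq_nonneg ((j : ℝ) - k)]
  set r := δ / 2 * J with hr
  have hr1 : δ / 2 ≤ r := le_mul_of_one_le_right (by positivity) hJ1
  set S := bisymSeminorm lam M 0 0 t a with hS
  have hS0 : 0 ≤ S := bisymSeminorm_nonneg hlam M
  set g : Vec n × Vec n × Vec n → ℂ := fun z =>
    a (resc h μ z).1 (resc h μ z).2.1 (resc h μ z).2.2 with hg
  have hgc : ContDiff ℝ (⊤ : ℕ∞) g := ha.1.comp (resc h μ).contDiff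
  have habs : ∀ x ∈ tsupport f, |x| ≤ 1 := fun x hx => by linarith [hmargin x hx]
  have hgb : ∀ m, ∀ z : Vec n × Vec n × Vec n, -(j : ℝ) + z.1 0 ∈ tsupport f →
      -(k : ℝ) + z.2.2 0 ∈ tsupport f →
      DBound (dirSet n h) m (bisymSeminorm lam m 0 0 t a) g z := by
    intro m z h1 h2
    refine dBound_comp_resc hlam ha m j k hh.1.ne' ?_ ?_
    · have := habs _ h1
      rwa [neg_add_eq_sub] at this
    · have := habs _ h2
      rwa [neg_add_eq_sub] at this
  set c := cutAmp f j k g with hcdef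
  have hnice : NiceAmp h c := by
    refine ⟨contDiff_cutAmp hf _ _ hgc, fun m => ?_⟩
    obtain ⟨K', hK', hcut'⟩ := exists_dBound_cutAmp (n := n) hf hc m
    have hm0 := bisymSeminorm_nonneg (t := t) (a := a) hlam m
    refine ⟨K' * bisymSeminorm lam m 0 0 t a, fun z => ?_⟩
    rcases hcut' h j k _ g hgc (hgb m) z with h0 | h0
    · exact h0.mono le_rfl (by positivity)
    · exact h0.1
  obtain ⟨b, hbn, hbint, hbd⟩ := hamp h hh c hnice (K * S) r hr1 fun z => by
    rcases hcut h j k S g hgc (hgb M) z with h0 | ⟨h0, h1, h2⟩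
    · exact Or.inl h0
    · exact Or.inr ⟨h0, le_abs_sub_of_margin hδ1 hδ hjk (hmargin _ h1) (hmargin _ h2)⟩
  set A := B * h ^ N * r⁻¹ ^ N * (K * S) with hA
  have hh0 := hh.1
  have hA0 : 0 ≤ A := by positivity
  set s := wt (n := n) μ with hs
  have hs0 : ∀ i, s i ≠ 0 := fun i => (wt_pos hμ i).ne'
  set v : Vec n → ℂ := fun y => u (diagL s y) with hv
  have hvc : ContDiff ℝ (⊤ : ℕ∞) v := hu.comp (diagL s).contDiff
  have hvs : HasCompactSupport v := hasCompactSupport_comp_diagL hs0 hcu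
  have key := lintegral_enorm_integral_oscInt_le hbn hA0 (fun z => hbd z (by positivity)) hvc hvs
  set D := 2 ^ (n + n) * A * W * (2 * π) ^ n with hD
  have hD0 : 0 ≤ D := by positivity
  have hfin : L2 (fun q => f (-(j : ℝ) + q 0) * Oph h a (fun q' => f (-(k : ℝ) + q' 0) * u q') q)
      ≤ ((2 * π) ^ (-(n : ℤ)) * D) * L2 u := by
    refine L2_le_of_lintegral_le (by positivity) hu hcu ?_
    rw [lintegral_enorm_diagL hs0, lintegral_enorm_diagL hs0 u, mul_left_comm]
    refine mul_le_mul_right ?_ _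
    have e : ∀ x, ‖f (-(j : ℝ) + diagL s x 0) *
        Oph h a (fun q' => f (-(k : ℝ) + q' 0) * u q') (diagL s x)‖ₑ ^ 2 =
        ENNReal.ofReal (((2 * π) ^ (-(n : ℤ))) ^ 2) * ‖∫ p, oscInt b v x p‖ₑ ^ 2 := by
      intro x
      rw [oph_cut_diagL f j k h hμ a u x, ← hbint v hvc hvs x, enorm_mul, mul_pow]
      congr 1
      rw [← ofReal_norm, Complex.norm_real, Real.norm_of_nonneg (by positivity),
        ENNReal.ofReal_pow (by positivity)]
    rw [lintegral_congr e, lintegral_const_mul' _ _ ENNReal.ofReal_ne_top, mul_pow,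
      ENNReal.ofReal_mul (by positivity), mul_assoc]
    exact mul_le_mul_right key _
  refine hfin.trans (le_of_eq ?_)
  congr 1
  have hpi : (2 * π) ^ (-(n : ℤ)) * (2 * π) ^ n = 1 := by
    rw [zpow_neg, zpow_natCast]
    exact inv_mul_cancel₀ (by positivity)
  have hJN : J ^ (-(N : ℤ)) = J⁻¹ ^ N := by rw [zpow_neg, zpow_natCast, inv_pow]
  rw [hD, hA, hr, mul_inv, mul_pow, hJN]
  linear_combination (2 ^ (n + n) * (B * h ^ N * ((δ / 2)⁻¹ ^ N * J⁻¹ ^ N) * (K * S)) * W) * hpi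

/-- **Proposition 3.7.**  Let `λ` satisfy the admissibility condition and `ψ` be the
partition-of-unity function.  For every `N ≥ 0` there are `C > 0` and `M ≥ 0` such that
`‖ψ_j Op_ħ(a) ψ_k‖_{L²→L²} ≤ C ħ^N ⟨j-k⟩^{-N} |a|_{λ:M,0,0,t}` for all `t ∈ [0,1]`,
all `a ∈ BS⁰₀(λ;t)`, all `j, k ∈ ℤ` with `|j-k| ≥ 2` and all `ħ ∈ (0,1]`. -/
theorem psi_Oph_psi_decay
    (n : ℕ) [NeZero n] (lam : ℝ → ℝ) (hlam : Admissible lam)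
    (ψ : ℝ → ℝ) (hψ : ContDiff ℝ (⊤ : ℕ∞) ψ) (hψsupp : tsupport ψ ⊆ Set.Ioo (-1 : ℝ) 1)
    (hψpos : ∀ r, 0 ≤ ψ r) (hψsum : ∀ r : ℝ, ∑' j : ℤ, ψ (r - j) = 1) (N : ℕ) :
    ∃ C > 0, ∃ M : ℕ, ∀ t ∈ Set.Icc (0 : ℝ) 1,
      ∀ a : Vec n → Vec n → Vec n → ℂ, IsBisymbol lam 0 0 t a →
        ∀ j k : ℤ, 2 ≤ |j - k| → ∀ h ∈ Set.Ioc (0 : ℝ) 1,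
          ∀ u : Vec n → ℂ, ContDiff ℝ (⊤ : ℕ∞) u → HasCompactSupport u →
            L2 (fun q => (ψ (q 0 - j) : ℂ) *
                  Oph h a (fun q' => (ψ (q' 0 - k) : ℂ) * u q') q)
              ≤ C * h ^ N * Real.sqrt (1 + ((j : ℝ) - k) ^ 2) ^ (-(N : ℤ)) *
                  bisymSeminorm lam M 0 0 t a * L2 u := by
  set f : ℝ → ℂ := fun r => (ψ r : ℂ) with hf
  have hfc : ContDiff ℝ (⊤ : ℕ∞) f := Complex.ofRealCLM.contDiff.comp hψ
  have hfs : tsupport f ⊆ Set.Ioo (-1 : ℝ) 1 := by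
    refine (closure_mono ?_).trans hψsupp
    intro r hr h0
    exact hr (by simp [hf, h0])
  obtain ⟨C, hC, M, hmain⟩ := exists_L2_cut_oph_cut_le (n := n) hlam.1 hfc hfs N
  refine ⟨C + 1, by positivity, M, ?_⟩
  intro t _ a ha j k hjk h hh u hu hcu
  have h1 := hmain t a ha j k hjk h hh u hu hcu
  simp only [neg_add_eq_sub, hf] at h1
  refine h1.trans ?_
  have h2 := bisymSeminorm_nonneg (t := t) (a := a) hlam.1 M
  have h3 : 0 ≤ L2 u := Real.sqrt_nonneg _
  have h4 := hh.1.le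
  gcongr
  linarith
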